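/- arXiv:1702.07555 — 2 statements merged into one kernel-verified Lean document; each statement's English description precedes it below -/
import Mathlib

section
/- Every set of n points in the plane in general position contains two disjoint subsets A and B, each of size ⌊√(n/2 + 1) − 1⌋, such that A avoids B and A and B can be separated by a line. -/
/-- The line { p | a x + b y = c } given by a triple (a, b, c). -/
def lineOf (l : ℝ × ℝ × ℝ) : Set (ℝ × ℝ) :=
  {p | l.1 * p.1 + l.2.1 * p.2 = l.2.2}

/-- Signed side value of a point with respect to a line (a, b, c). -/
def sideVal (l : ℝ × ℝ × ℝ) (p : ℝ × ℝ) : ℝ :=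
  l.1 * p.1 + l.2.1 * p.2 - l.2.2

/-- The union of the lines of an arrangement. -/
def linesUnion (S : Finset (ℝ × ℝ × ℝ)) : Set (ℝ × ℝ) :=
  ⋃ l ∈ S, lineOf l

/-- An unbounded region of a line arrangement: an unbounded connected component
of the complement of the union of the lines. -/
def IsUnboundedRegion (S : Finset (ℝ × ℝ × ℝ)) (U : Set (ℝ × ℝ)) : Prop :=
  (∃ p ∈ (linesUnion S)ᶜ, U = connectedComponentIn (linesUnion S)ᶜ p) ∧
  ¬ Bornology.IsBounded U

/-- A spoke set for P: a set of pairwise non-parallel lines such that every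
unbounded region of the arrangement contains a point of P. -/
def SpokeSet (P : Finset (ℝ × ℝ)) (S : Finset (ℝ × ℝ × ℝ)) : Prop :=
  (∀ l ∈ S, (l.1, l.2.1) ≠ (0, 0)) ∧
  (∀ l ∈ S, ∀ m ∈ S, l ≠ m → l.1 * m.2.1 - l.2.1 * m.1 ≠ 0) ∧
  (∀ U, IsUnboundedRegion S U → ∃ p ∈ P, (p : ℝ × ℝ) ∈ U)

/-- General position: no three distinct points collinear. -/
def GenPos (P : Set (ℝ × ℝ)) : Prop :=
  ∀ p ∈ P, ∀ q ∈ P, ∀ r ∈ P, p ≠ q → p ≠ r → q ≠ r → ¬ Collinear ℝ {p, q, r}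

/-- A avoids B: no line through two distinct points of A meets the convex hull of B. -/
def Avoids (A B : Finset (ℝ × ℝ)) : Prop :=
  ∀ a₁ ∈ A, ∀ a₂ ∈ A, a₁ ≠ a₂ →
    ∀ x ∈ (affineSpan ℝ {a₁, a₂} : Set (ℝ × ℝ)), x ∉ convexHull ℝ (B : Set (ℝ × ℝ))

/-- A and B can be separated by a line (A strictly on one side, B on the other). -/
def SeparatedByLine (A B : Finset (ℝ × ℝ)) : Prop :=
  ∃ l : ℝ × ℝ × ℝ, (l.1, l.2.1) ≠ (0, 0) ∧
    (∀ a ∈ A, sideVal l a < 0) ∧ (∀ b ∈ B, 0 < sideVal l b)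

/-- The supporting line of the segment from p to q. -/
def suppLine (p q : ℝ × ℝ) : Set (ℝ × ℝ) := (affineSpan ℝ {p, q} : Set (ℝ × ℝ))

/-- Two segments cross: the (unique) intersection point of their supporting
lines lies in both segments. -/
def SegCross (p₁ p₂ q₁ q₂ : ℝ × ℝ) : Prop :=
  ∃ s, suppLine p₁ p₂ ∩ suppLine q₁ q₂ = {s} ∧
    s ∈ segment ℝ p₁ p₂ ∧ s ∈ segment ℝ q₁ q₂

/-- The segment (p₁,p₂) stabs the segment (q₁,q₂): the intersection point of the
supporting lines lies in (q₁,q₂) but not in (p₁,p₂). -/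
def SegStabs (p₁ p₂ q₁ q₂ : ℝ × ℝ) : Prop :=
  ∃ s, suppLine p₁ p₂ ∩ suppLine q₁ q₂ = {s} ∧
    s ∈ segment ℝ q₁ q₂ ∧ s ∉ segment ℝ p₁ p₂

/-- Two segments are parallel: every common point of the supporting lines lies
in neither segment (this also covers parallel supporting lines). -/
def SegParallel (p₁ p₂ q₁ q₂ : ℝ × ℝ) : Prop :=
  ∀ s ∈ suppLine p₁ p₂ ∩ suppLine q₁ q₂,
    s ∉ segment ℝ p₁ p₂ ∧ s ∉ segment ℝ q₁ q₂

/-- v is the stabbing vertex of (p₁,p₂) with respect to (q₁,q₂): (p₁,p₂) stabs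
(q₁,q₂) and v is the endpoint of (p₁,p₂) closer to the intersection point. -/
def StabVertex (p₁ p₂ q₁ q₂ v : ℝ × ℝ) : Prop :=
  ∃ s, suppLine p₁ p₂ ∩ suppLine q₁ q₂ = {s} ∧
    s ∈ segment ℝ q₁ q₂ ∧ s ∉ segment ℝ p₁ p₂ ∧
    ((v = p₁ ∧ dist p₁ s ≤ dist p₂ s) ∨ (v = p₂ ∧ dist p₂ s ≤ dist p₁ s))

/-- Two unbounded regions are antipodal: they lie strictly on opposite sides
of every line of the arrangement. -/
def AntipodalRegions (S : Finset (ℝ × ℝ × ℝ)) (U V : Set (ℝ × ℝ)) : Prop :=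
  IsUnboundedRegion S U ∧ IsUnboundedRegion S V ∧
  ∀ l ∈ S, ∀ u ∈ U, ∀ v ∈ V, sideVal l u * sideVal l v < 0

/-- The endpoints of the edges of a matching. -/
noncomputable def endpoints (M : Finset ((ℝ × ℝ) × (ℝ × ℝ))) : Finset (ℝ × ℝ) :=
  M.image Prod.fst ∪ M.image Prod.snd

/-- M is the spoke matching of the spoke set S for P: its endpoints are points
of P, each unbounded region of the arrangement of S contains exactly one
endpoint of M, and each edge of M joins points in antipodal regions. -/
def SpokeMatching (P : Finset (ℝ × ℝ)) (S : Finset (ℝ × ℝ × ℝ))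
    (M : Finset ((ℝ × ℝ) × (ℝ × ℝ))) : Prop :=
  SpokeSet P S ∧
  (∀ e ∈ M, e.1 ∈ P ∧ e.2 ∈ P) ∧
  (∀ U, IsUnboundedRegion S U → ∃! p, p ∈ endpoints M ∧ p ∈ U) ∧
  (∀ e ∈ M, ∃ U V, AntipodalRegions S U V ∧ e.1 ∈ U ∧ e.2 ∈ V)



namespace AvoidAux

open AffineSubspace AffineMap

/-- Erdős–Szekeres in chain form. -/
lemma es {α : Type*} [DecidableEq α] (u v : α → ℝ) (l : ℕ) :
    ∀ (k : ℕ) (A : Finset α), k * l < A.card →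
      (∃ C ⊆ A, C.card = k + 1 ∧ (∀ a ∈ C, ∀ b ∈ C, (u a ≤ u b ∧ v a ≤ v b) ∨ (u b ≤ u a ∧ v b ≤ v a))
        ∧ ∃ c ∈ C, ∀ d ∈ C, u c ≤ u d ∧ v c ≤ v d) ∨
      (∃ C ⊆ A, C.card = l + 1 ∧
        (∀ a ∈ C, ∀ b ∈ C, (u a ≤ u b ∧ v b ≤ v a) ∨ (u b ≤ u a ∧ v a ≤ v b))) := by
  intro k
  induction k with
  | zero =>
    intro A hA
    left
    have : 0 < A.card := by omega
    obtain ⟨a, ha⟩ := Finset.card_pos.1 this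
    refine ⟨{a}, by simpa using ha, by simp, ?_, a, by simp, ?_⟩
    · intro x hx y hy
      simp at hx hy
      subst hx; subst hy; left; exact ⟨le_rfl, le_rfl⟩
    · intro x hx
      simp at hx
      subst hx; exact ⟨le_rfl, le_rfl⟩
  | succ k ih =>
    intro A hA
    classical
    set M := A.filter (fun c => ∀ a ∈ A, u a ≤ u c → v a ≤ v c → (u c ≤ u a ∧ v c ≤ v a)) with hM
    have hMA : M ⊆ A := Finset.filter_subset _ _
    by_cases hc : l + 1 ≤ M.card
    · right
      obtain ⟨C, hC, hcard⟩ := Finset.exists_subset_card_eq hc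
      refine ⟨C, hC.trans hMA, hcard, ?_⟩
      intro a ha b hb
      have ha' := (Finset.mem_filter.1 (hC ha))
      have hb' := (Finset.mem_filter.1 (hC hb))
      have h1 := ha'.2 b hb'.1
      have h2 := hb'.2 a ha'.1
      rcases le_total (u a) (u b) with h | h <;> rcases le_total (v a) (v b) with h' | h'
      · have := h2 h h'; right; exact ⟨this.1, h'⟩
      · left; exact ⟨h, h'⟩
      · right; exact ⟨h, h'⟩
      · have := h1 h h'; left; exact ⟨this.1, h'⟩
    · have hcard : (A \ M).card = A.card - M.card := Finset.card_sdiff_of_subset hMA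
      have hlt : k * l < (A \ M).card := by
        rw [hcard]
        have : (k + 1) * l = k * l + l := by ring
        omega
      rcases ih (A \ M) hlt with ⟨C, hC, hcd, hch, c, hcC, hmin⟩ | ⟨C, hC, hcd, hch⟩
      · left
        have hcA := Finset.mem_sdiff.1 (hC hcC)
        have : ∃ a ∈ A, u a ≤ u c ∧ v a ≤ v c ∧ ¬ (u c ≤ u a ∧ v c ≤ v a) := by
          by_contra hcon
          push Not at hcon
          apply hcA.2
          rw [hM, Finset.mem_filter]
          refine ⟨hcA.1, fun a ha h1 h2 => ?_⟩
          exact hcon a ha h1 h2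
        obtain ⟨a, haA, h1, h2, h3⟩ := this
        have haC : a ∉ C := fun h => h3 (hmin a h)
        refine ⟨insert a C, ?_, ?_, ?_, a, by simp, ?_⟩
        · intro x hx
          rcases Finset.mem_insert.1 hx with rfl | hx
          · exact haA
          · exact (Finset.mem_sdiff.1 (hC hx)).1
        · rw [Finset.card_insert_of_notMem haC, hcd]
        · intro x hx y hy
          rcases Finset.mem_insert.1 hx with hx' | hx' <;>
            rcases Finset.mem_insert.1 hy with hy' | hy'
          · rw [hx', hy']; left; exact ⟨le_rfl, le_rfl⟩
          · rw [hx']; left; exact ⟨h1.trans (hmin y hy').1, h2.trans (hmin y hy').2⟩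
          · rw [hy']; right; exact ⟨h1.trans (hmin x hx').1, h2.trans (hmin x hx').2⟩
          · exact hch x hx' y hy'
        · intro x hx
          rcases Finset.mem_insert.1 hx with rfl | hx
          · exact ⟨le_rfl, le_rfl⟩
          · exact ⟨h1.trans (hmin x hx).1, h2.trans (hmin x hx).2⟩
      · right
        exact ⟨C, hC.trans Finset.sdiff_subset, hcd, hch⟩

/-- Threshold lemma. -/
lemma threshold {α : Type*} [DecidableEq α] (P : Finset α) (f : α → ℝ) (d j : ℕ) (hj : 1 ≤ j)
    (hP : j ≤ P.card) (hd : ∀ v, (P.filter (fun p => f p = v)).card ≤ d) :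
    ∃ s, j ≤ (P.filter (fun p => s < f p)).card ∧
      (P.filter (fun p => s < f p)).card + 1 ≤ j + d ∧ ∀ p ∈ P, f p ≠ s := by
  classical
  -- points whose upper set has at least j elements
  set Q := P.filter (fun q => j ≤ (P.filter (fun p => f q ≤ f p)).card) with hQ
  have hPne : P.Nonempty := Finset.card_pos.1 (by omega)
  have hQne : Q.Nonempty := by
    obtain ⟨q, hq, hmin⟩ := Finset.exists_min_image P f hPne
    refine ⟨q, Finset.mem_filter.2 ⟨hq, ?_⟩⟩
    rw [Finset.filter_true_of_mem hmin]; exact hP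
  obtain ⟨q, hq, hmax⟩ := Finset.exists_max_image Q f hQne
  have hq' := Finset.mem_filter.1 hq
  have hgt : (P.filter (fun p => f q < f p)).card < j := by
    by_contra hcon
    push Not at hcon
    have hne : (P.filter (fun p => f q < f p)).Nonempty := Finset.card_pos.1 (by omega)
    obtain ⟨r, hr, hrmin⟩ := Finset.exists_min_image _ f hne
    have hr' := Finset.mem_filter.1 hr
    have : r ∈ Q := by
      refine Finset.mem_filter.2 ⟨hr'.1, hcon.trans (Finset.card_le_card ?_)⟩
      intro p hp
      exact Finset.mem_filter.2 ⟨(Finset.mem_filter.1 hp).1, hrmin p hp⟩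
    have := hmax r this
    linarith [hr'.2]
  have hge : (P.filter (fun p => f q ≤ f p)).card ≤
      (P.filter (fun p => f q < f p)).card + (P.filter (fun p => f p = f q)).card := by
    refine le_trans (Finset.card_le_card ?_) (Finset.card_union_le _ _)
    intro p hp
    have hp' := Finset.mem_filter.1 hp
    rcases lt_or_eq_of_le hp'.2 with h | h
    · exact Finset.mem_union_left _ (Finset.mem_filter.2 ⟨hp'.1, h⟩)
    · exact Finset.mem_union_right _ (Finset.mem_filter.2 ⟨hp'.1, h.symm⟩)
  have hdq := hd (f q)
  -- s just below f q
  have hs : ∃ s, s < f q ∧ ∀ p ∈ P, f p < f q → f p < s := by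
    by_cases hne : (P.filter (fun p => f p < f q)).Nonempty
    · obtain ⟨r, hr, hrmax⟩ := Finset.exists_max_image _ f hne
      have hr' := (Finset.mem_filter.1 hr).2
      refine ⟨(f r + f q) / 2, by linarith, fun p hp h => ?_⟩
      have := hrmax p (Finset.mem_filter.2 ⟨hp, h⟩)
      linarith
    · refine ⟨f q - 1, by linarith, fun p hp h => ?_⟩
      exact absurd ⟨p, Finset.mem_filter.2 ⟨hp, h⟩⟩ hne
  obtain ⟨s, hsq, hs⟩ := hs
  have heq : P.filter (fun p => s < f p) = P.filter (fun p => f q ≤ f p) := by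
    apply Finset.filter_congr
    intro p hp
    constructor
    · intro h
      by_contra h'
      push Not at h'
      linarith [hs p hp h']
    · intro h; linarith
  refine ⟨s, ?_, ?_, ?_⟩
  · rw [heq]; exact hq'.2
  · rw [heq]; omega
  · intro p hp h
    by_cases h' : f p < f q
    · linarith [hs p hp h']
    · linarith

lemma real_core {x x' xb s s' sb : ℝ} (hxb : 0 < xb) (hx' : x' < 0) (hxx : x ≤ x')
    (hss : s ≤ s') (hsb : s' < sb) (hne : x < x' ∨ s < s') :
    0 < xb * (x' * (sb - s') - x * (sb - s)) + x * x' * (s' - s) := by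
  have e : xb * (x' * (sb - s') - x * (sb - s)) + x * x' * (s' - s)
      = xb * ((x' - x) * (sb - s')) + xb * ((-x) * (s' - s)) + (x * x') * (s' - s) := by ring
  rw [e]
  have hx : x < 0 := by linarith
  have hxx' : 0 < x * x' := mul_pos_of_neg_of_neg hx hx'
  have h1 : 0 ≤ xb * ((x' - x) * (sb - s')) := by
    apply mul_nonneg hxb.le (mul_nonneg (by linarith) (by linarith))
  have h2 : 0 ≤ xb * ((-x) * (s' - s)) := by
    apply mul_nonneg hxb.le (mul_nonneg (by linarith) (by linarith))
  have h3 : 0 ≤ (x * x') * (s' - s) := mul_nonneg hxx'.le (by linarith)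
  rcases hne with h | h
  · have : 0 < xb * ((x' - x) * (sb - s')) :=
      mul_pos hxb (mul_pos (by linarith) (by linarith))
    linarith
  · have : 0 < (x * x') * (s' - s) := mul_pos hxx' (by linarith)
    linarith

/-- cross product -/
def cr (a a' z : ℝ × ℝ) : ℝ := (a'.1 - a.1) * (z.2 - a.2) - (a'.2 - a.2) * (z.1 - a.1)

lemma cr_span {a a' z : ℝ × ℝ} (h : z ∈ (affineSpan ℝ {a, a'} : Set (ℝ × ℝ))) : cr a a' z = 0 := by
  rw [SetLike.mem_coe, mem_affineSpan_pair_iff_exists_lineMap_eq] at h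
  obtain ⟨r, rfl⟩ := h
  simp [cr, AffineMap.lineMap_apply]
  ring

lemma avoid_of_cr (A B : Finset (ℝ × ℝ))
    (h : ∀ a ∈ A, ∀ a' ∈ A, a ≠ a' → ∃ e : ℝ, ∀ b ∈ B, 0 < e * cr a a' b) : Avoids A B := by
  intro a ha a' ha' hne x hx hxB
  obtain ⟨e, he⟩ := h a ha a' ha' hne
  have hconv : Convex ℝ {z : ℝ × ℝ | 0 < e * cr a a' z} := by
    intro p hp q hq α β hα hβ hαβ
    simp only [Set.mem_ofPred_eq] at *
    have : e * cr a a' (α • p + β • q) = α * (e * cr a a' p) + β * (e * cr a a' q) := by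
      have hb : β = 1 - α := by linarith
      subst hb
      simp [cr]
      ring
    rw [this]
    rcases hα.eq_or_lt with h0 | h0
    · subst h0
      have : β = 1 := by linarith
      subst this; simpa using hq
    · have := mul_pos h0 hp
      have := mul_nonneg hβ hq.le
      linarith
  have h0 : 0 < e * cr a a' x :=
    convexHull_min (s := (B : Set (ℝ × ℝ))) (fun b hb => he b hb) hconv hxB
  rw [cr_span hx] at h0
  simp at h0

/-- sheared first coordinate -/
def XX (θ c : ℝ) (p : ℝ × ℝ) : ℝ := p.1 + θ * p.2 - c

/-- slope as seen from the point at height `t` -/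
noncomputable def sg (θ c t : ℝ) (p : ℝ × ℝ) : ℝ := (p.2 - t) / XX θ c p

lemma cr_eq (θ c t : ℝ) (a a' b : ℝ × ℝ) (ha : XX θ c a ≠ 0) (ha' : XX θ c a' ≠ 0)
    (hb : XX θ c b ≠ 0) :
    cr a a' b = XX θ c b * (XX θ c a' * (sg θ c t b - sg θ c t a') -
      XX θ c a * (sg θ c t b - sg θ c t a)) +
      XX θ c a * XX θ c a' * (sg θ c t a' - sg θ c t a) := by
  have h1 : a.2 - t = sg θ c t a * XX θ c a := by rw [sg]; field_simp
  have h2 : a'.2 - t = sg θ c t a' * XX θ c a' := by rw [sg]; field_simp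
  have h3 : b.2 - t = sg θ c t b * XX θ c b := by rw [sg]; field_simp
  have e : cr a a' b = (XX θ c a' - XX θ c a) * ((b.2 - t) - (a.2 - t))
      - ((a'.2 - t) - (a.2 - t)) * (XX θ c b - XX θ c a) := by
    simp only [cr, XX]; ring
  rw [e, h1, h2, h3]; ring

lemma pt_ne (θ c t : ℝ) {a a' : ℝ × ℝ} (ha : XX θ c a ≠ 0) (ha' : XX θ c a' ≠ 0)
    (h1 : XX θ c a = XX θ c a') (h2 : sg θ c t a = sg θ c t a') : a = a' := by
  have h3 : a.2 - t = sg θ c t a * XX θ c a := by rw [sg]; field_simp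
  have h4 : a'.2 - t = sg θ c t a' * XX θ c a' := by rw [sg]; field_simp
  have h5 : a.2 = a'.2 := by
    have : a.2 - t = a'.2 - t := by rw [h3, h4, h1, h2]
    linarith
  have h6 : a.1 = a'.1 := by
    simp only [XX, h5] at h1; linarith
  exact Prod.ext h6 h5

lemma core (θ c t ε δ : ℝ) (hε : ε = 1 ∨ ε = -1) (hδ : δ = 1 ∨ δ = -1) (A B : Finset (ℝ × ℝ))
    (hA : ∀ a ∈ A, ε * XX θ c a < 0) (hB : ∀ b ∈ B, 0 < ε * XX θ c b)
    (hAB : ∀ a ∈ A, ∀ b ∈ B, δ * sg θ c t a < δ * sg θ c t b)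
    (hch : ∀ a ∈ A, ∀ a' ∈ A,
      (ε * XX θ c a ≤ ε * XX θ c a' ∧ δ * sg θ c t a ≤ δ * sg θ c t a') ∨
      (ε * XX θ c a' ≤ ε * XX θ c a ∧ δ * sg θ c t a' ≤ δ * sg θ c t a)) :
    Avoids A B := by
  have hε2 : ε * ε = 1 := by rcases hε with rfl | rfl <;> norm_num
  have hε0 : ε ≠ 0 := by rintro rfl; simp at hε2
  have hδ0 : δ ≠ 0 := by rcases hδ with rfl | rfl <;> norm_num
  have hneA : ∀ a ∈ A, XX θ c a ≠ 0 := fun a ha h => by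
    have := hA a ha; rw [h] at this; simp at this
  have hneB : ∀ a ∈ B, XX θ c a ≠ 0 := fun a ha h => by
    have := hB a ha; rw [h] at this; simp at this
  have key : ∀ a ∈ A, ∀ a' ∈ A, a ≠ a' →
      (ε * XX θ c a ≤ ε * XX θ c a' ∧ δ * sg θ c t a ≤ δ * sg θ c t a') →
      ∀ b ∈ B, 0 < δ * cr a a' b := by
    intro a ha a' ha' hne ⟨h1, h2⟩ b hb
    have hlt : ε * XX θ c a < ε * XX θ c a' ∨ δ * sg θ c t a < δ * sg θ c t a' := by
      by_contra hcon
      push Not at hcon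
      apply hne
      apply pt_ne θ c t (hneA a ha) (hneA a' ha')
      · exact mul_left_cancel₀ hε0 (le_antisymm h1 hcon.1)
      · exact mul_left_cancel₀ hδ0 (le_antisymm h2 hcon.2)
    have := real_core (hB b hb) (hA a' ha') h1 h2 (hAB a' ha' b hb) hlt
    rw [cr_eq θ c t a a' b (hneA a ha) (hneA a' ha') (hneB b hb)]
    rcases hε with rfl | rfl <;> rcases hδ with rfl | rfl <;> ring_nf at this ⊢ <;> linarith
  apply avoid_of_cr
  intro a ha a' ha' hne
  rcases hch a ha a' ha' with h | h
  · exact ⟨δ, key a ha a' ha' hne h⟩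
  · refine ⟨-δ, fun b hb => ?_⟩
    have := key a' ha' a ha hne.symm h b hb
    have e : cr a' a b = - cr a a' b := by simp only [cr]; ring
    rw [e] at this
    linarith

/-- the final assembly -/
lemma assemble (θ c t ε s₁ s₂ : ℝ) (hε : ε = 1 ∨ ε = -1) (k : ℕ) (hk : 1 ≤ k)
    (L R : Finset (ℝ × ℝ)) (hL : ∀ a ∈ L, ε * XX θ c a < 0) (hR : ∀ b ∈ R, 0 < ε * XX θ c b)
    (hcard : k ^ 2 + 2 * k ≤ L.card)
    (h1 : k ≤ (R.filter (fun p => s₁ < sg θ c t p)).card)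
    (h2 : (L.filter (fun p => s₁ ≤ sg θ c t p)).card ≤ k)
    (h3 : k ≤ (R.filter (fun p => sg θ c t p < s₂)).card)
    (h4 : (L.filter (fun p => sg θ c t p ≤ s₂)).card ≤ k) :
    ∃ A B : Finset (ℝ × ℝ), A ⊆ L ∧ B ⊆ R ∧ A.card = k ∧ B.card = k ∧ Avoids A B := by
  classical
  set A₀ := (L \ L.filter (fun p => s₁ ≤ sg θ c t p)) \ L.filter (fun p => sg θ c t p ≤ s₂) with hA₀
  have hc0 : k ^ 2 ≤ A₀.card := by
    have e1 := Finset.le_card_sdiff (L.filter (fun p => s₁ ≤ sg θ c t p)) L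
    have e2 := Finset.le_card_sdiff (L.filter (fun p => sg θ c t p ≤ s₂))
      (L \ L.filter (fun p => s₁ ≤ sg θ c t p))
    rw [← hA₀] at e2
    omega
  have hmem : ∀ a ∈ A₀, a ∈ L ∧ sg θ c t a < s₁ ∧ s₂ < sg θ c t a := by
    intro a ha
    simp only [hA₀, Finset.mem_sdiff, Finset.mem_filter, not_and, not_le] at ha
    exact ⟨ha.1.1, ha.1.2 ha.1.1, ha.2 ha.1.1⟩
  have hlt : (k - 1) * (k - 1) < A₀.card := by
    obtain ⟨j, rfl⟩ : ∃ j, k = j + 1 := ⟨k - 1, by omega⟩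
    simp only [Nat.add_sub_cancel]
    nlinarith
  rcases es (fun p => ε * XX θ c p) (sg θ c t) (k - 1) (k - 1) A₀ hlt with
    ⟨C, hC, hCc, hch, -⟩ | ⟨C, hC, hCc, hch⟩
  · obtain ⟨B, hB, hBc⟩ := Finset.exists_subset_card_eq h1
    refine ⟨C, B, fun a ha => (hmem a (hC ha)).1, hB.trans (Finset.filter_subset _ _), by omega, hBc, ?_⟩
    apply core θ c t ε 1 hε (Or.inl rfl) C B
    · exact fun a ha => hL a (hmem a (hC ha)).1
    · exact fun b hb => hR b (Finset.mem_filter.1 (hB hb)).1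
    · intro a ha b hb
      have := (hmem a (hC ha)).2.1
      have := (Finset.mem_filter.1 (hB hb)).2
      linarith
    · intro a ha a' ha'
      simpa using hch a ha a' ha'
  · obtain ⟨B, hB, hBc⟩ := Finset.exists_subset_card_eq h3
    refine ⟨C, B, fun a ha => (hmem a (hC ha)).1, hB.trans (Finset.filter_subset _ _), by omega, hBc, ?_⟩
    apply core θ c t ε (-1) hε (Or.inr rfl) C B
    · exact fun a ha => hL a (hmem a (hC ha)).1
    · exact fun b hb => hR b (Finset.mem_filter.1 (hB hb)).1
    · intro a ha b hb
      have := (hmem a (hC ha)).2.2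
      have := (Finset.mem_filter.1 (hB hb)).2
      linarith
    · intro a ha a' ha'
      simpa using hch a ha a' ha'

/-- the open condition -/
def cond (θ c δ : ℝ) (k : ℕ) (R L : Finset (ℝ × ℝ)) (t : ℝ) : Prop :=
  ∃ s : ℝ, k ≤ (R.filter (fun p => s < δ * sg θ c t p)).card ∧
    (L.filter (fun p => s ≤ δ * sg θ c t p)).card ≤ k

lemma sg_cont (θ c : ℝ) (p : ℝ × ℝ) : Continuous (fun t => sg θ c t p) := by
  unfold sg; fun_prop

lemma cond_open (θ c δ : ℝ) (k : ℕ) (R L : Finset (ℝ × ℝ)) :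
    IsOpen {t | cond θ c δ k R L t} := by
  rw [isOpen_iff_mem_nhds]
  rintro t ⟨s, h1, h2⟩
  have e1 : ∀ᶠ t' in nhds t, ∀ p ∈ R, s < δ * sg θ c t p → s < δ * sg θ c t' p := by
    rw [Filter.eventually_all_finset]
    intro p hp
    by_cases h : s < δ * sg θ c t p
    · filter_upwards [(((sg_cont θ c p).const_mul δ).tendsto t).eventually (lt_mem_nhds h)] with t' ht' _
      exact ht'
    · exact Filter.Eventually.of_forall fun _ h' => absurd h' h
  have e2 : ∀ᶠ t' in nhds t, ∀ p ∈ L, δ * sg θ c t p < s → δ * sg θ c t' p < s := by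
    rw [Filter.eventually_all_finset]
    intro p hp
    by_cases h : δ * sg θ c t p < s
    · filter_upwards [(((sg_cont θ c p).const_mul δ).tendsto t).eventually (gt_mem_nhds h)] with t' ht' _
      exact ht'
    · exact Filter.Eventually.of_forall fun _ h' => absurd h' h
  filter_upwards [e1, e2] with t' h1' h2'
  refine ⟨s, h1.trans (Finset.card_le_card ?_), (Finset.card_le_card ?_).trans h2⟩
  · intro p hp
    have hp := Finset.mem_filter.1 hp
    exact Finset.mem_filter.2 ⟨hp.1, h1' p hp.1 hp.2⟩
  · intro p hp
    have hp := Finset.mem_filter.1 hp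
    refine Finset.mem_filter.2 ⟨hp.1, ?_⟩
    by_contra h
    push Not at h
    linarith [h2' p hp.1 h]

lemma cond_or (θ c δ : ℝ) (hδ : δ = 1 ∨ δ = -1) (k : ℕ) (hk : 1 ≤ k) (P R L : Finset (ℝ × ℝ))
    (hgp : GenPos (P : Set (ℝ × ℝ))) (hX : ∀ p ∈ P, XX θ c p ≠ 0)
    (hd : Disjoint R L) (hu : R ∪ L = P) (hcard : 2 * k ≤ P.card) (t : ℝ) :
    cond θ c δ k R L t ∨ cond θ c δ k L R t := by
  classical
  have hfib : ∀ v, (P.filter (fun p => δ * sg θ c t p = v)).card ≤ 2 := by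
    intro v
    by_contra hcon
    push Not at hcon
    obtain ⟨p, q, r, hp, hq, hr, hpq, hpr, hqr⟩ := Finset.two_lt_card_iff.1 hcon
    have hp := Finset.mem_filter.1 hp
    have hq := Finset.mem_filter.1 hq
    have hr := Finset.mem_filter.1 hr
    apply hgp p hp.1 q hq.1 r hr.1 hpq hpr hqr
    have hδ0 : δ ≠ 0 := by rcases hδ with rfl | rfl <;> norm_num
    have key : ∀ z ∈ P, δ * sg θ c t z = v → z.2 - t = v / δ * XX θ c z := by
      intro z hz h
      have h0 := hX z hz
      rw [← h, sg]; field_simp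
    have kp := key p hp.1 hp.2
    have kq := key q hq.1 hq.2
    have kr := key r hr.1 hr.2
    set m := v / δ
    rw [collinear_iff_of_mem (p₀ := p) (by simp)]
    refine ⟨(1 - θ * m, m), ?_⟩
    have aux : ∀ z : ℝ × ℝ, z.2 - t = m * XX θ c z →
        z = (XX θ c z - XX θ c p) • ((1 - θ * m, m) : ℝ × ℝ) +ᵥ p := by
      intro z hz
      have e : z.2 - p.2 = m * (XX θ c z - XX θ c p) := by linarith
      have e2 : z.1 - p.1 = (XX θ c z - XX θ c p) - θ * (z.2 - p.2) := by
        simp only [XX]; ring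
      apply Prod.ext
      · simp only [vadd_eq_add, Prod.fst_add, Prod.smul_fst, smul_eq_mul]
        rw [e] at e2
        linarith
      · simp only [vadd_eq_add, Prod.snd_add, Prod.smul_snd, smul_eq_mul]
        linarith
    intro z hz
    simp only [Set.mem_insert_iff, Set.mem_singleton_iff] at hz
    rcases hz with rfl | rfl | rfl
    · exact ⟨_, aux _ kp⟩
    · exact ⟨_, aux _ kq⟩
    · exact ⟨_, aux _ kr⟩
  obtain ⟨s, h1, h2, h3⟩ := threshold P (fun p => δ * sg θ c t p) 2 (2 * k - 1) (by omega)
    (by omega) hfib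
  have hsum : (P.filter (fun p => s < δ * sg θ c t p)).card =
      (R.filter (fun p => s < δ * sg θ c t p)).card + (L.filter (fun p => s < δ * sg θ c t p)).card := by
    rw [← hu, Finset.filter_union, Finset.card_union_of_disjoint]
    exact Finset.disjoint_filter_filter hd
  have hle : ∀ Q ⊆ P, Q.filter (fun p => s ≤ δ * sg θ c t p) = Q.filter (fun p => s < δ * sg θ c t p) := by
    intro Q hQ
    apply Finset.filter_congr
    intro p hp
    have := h3 p (hQ hp)
    exact ⟨fun h => lt_of_le_of_ne h (Ne.symm this), le_of_lt⟩
  have hRP : R ⊆ P := hu ▸ Finset.subset_union_left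
  have hLP : L ⊆ P := hu ▸ Finset.subset_union_right
  by_cases h : k ≤ (R.filter (fun p => s < δ * sg θ c t p)).card
  · left
    refine ⟨s, h, ?_⟩
    rw [hle L hLP]; omega
  · right
    refine ⟨s, by omega, ?_⟩
    rw [hle R hRP]; omega

lemma exists_t (θ c : ℝ) (k : ℕ) (hk : 1 ≤ k) (P R L : Finset (ℝ × ℝ))
    (hgp : GenPos (P : Set (ℝ × ℝ))) (hR : ∀ p ∈ R, 0 < XX θ c p) (hL : ∀ p ∈ L, XX θ c p < 0)
    (hd : Disjoint R L) (hu : R ∪ L = P) (hRc : k ≤ R.card) (hLc : k ≤ L.card) :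
    ∃ t, (cond θ c 1 k R L t ∧ cond θ c (-1) k R L t) ∨
      (cond θ c 1 k L R t ∧ cond θ c (-1) k L R t) := by
  classical
  have hX : ∀ p ∈ P, XX θ c p ≠ 0 := by
    intro p hp
    rw [← hu] at hp
    rcases Finset.mem_union.1 hp with h | h
    · exact (hR p h).ne'
    · exact (hL p h).ne
  have hcard : 2 * k ≤ P.card := by
    rw [← hu, Finset.card_union_of_disjoint hd]; omega
  have o1 := cond_or θ c 1 (Or.inl rfl) k hk P R L hgp hX hd hu hcard
  have o2 := cond_or θ c (-1) (Or.inr rfl) k hk P R L hgp hX hd hu hcard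
  by_contra hcon
  push Not at hcon
  obtain ⟨T, hT⟩ : ∃ T : ℝ, ∀ p ∈ P, |p.2| < T := by
    obtain ⟨M, hM⟩ := (P.image (fun p => |p.2|)).exists_le
    refine ⟨M + 1, fun p hp => ?_⟩
    have := hM _ (Finset.mem_image_of_mem _ hp)
    linarith
  have hRP : R ⊆ P := hu ▸ Finset.subset_union_left
  have hLP : L ⊆ P := hu ▸ Finset.subset_union_right
  have n1 : cond θ c 1 k L R T := by
    refine ⟨0, ?_, ?_⟩
    · rw [Finset.filter_true_of_mem]
      · exact hLc
      · intro p hp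
        rw [one_mul, sg]
        have := abs_lt.1 (hT p (hLP hp))
        exact div_pos_of_neg_of_neg (by linarith) (hL p hp)
    · rw [Finset.filter_false_of_mem]
      · simp
      · intro p hp
        rw [one_mul, sg, not_le]
        have := abs_lt.1 (hT p (hRP hp))
        exact div_neg_of_neg_of_pos (by linarith) (hR p hp)
  have n2 : cond θ c 1 k R L (-T) := by
    refine ⟨0, ?_, ?_⟩
    · rw [Finset.filter_true_of_mem]
      · exact hRc
      · intro p hp
        rw [one_mul, sg]
        have := abs_lt.1 (hT p (hRP hp))
        exact div_pos (by linarith) (hR p hp)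
    · rw [Finset.filter_false_of_mem]
      · simp
      · intro p hp
        rw [one_mul, sg, not_le]
        have := abs_lt.1 (hT p (hLP hp))
        exact div_neg_of_pos_of_neg (by linarith) (hL p hp)
  have := isPreconnected_univ (α := ℝ) _ _ (cond_open θ c 1 k R L) (cond_open θ c 1 k L R)
    (fun t _ => o1 t) ⟨-T, trivial, n2⟩ ⟨T, trivial, n1⟩
  obtain ⟨t, -, h1, h2⟩ := this
  rcases o2 t with h | h
  · exact (hcon t).1 h1 h
  · exact (hcon t).2 h2 h

lemma exists_theta (P : Finset (ℝ × ℝ)) :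
    ∃ θ : ℝ, ∀ p ∈ P, ∀ q ∈ P, p.1 + θ * p.2 = q.1 + θ * q.2 → p = q := by
  classical
  obtain ⟨θ, hθ⟩ := Infinite.exists_notMem_finset
    ((P ×ˢ P).image (fun z => -(z.1.1 - z.2.1) / (z.1.2 - z.2.2)))
  refine ⟨θ, fun p hp q hq h => ?_⟩
  by_cases h2 : p.2 = q.2
  · rw [h2] at h
    exact Prod.ext (by linarith) h2
  · exfalso
    apply hθ
    refine Finset.mem_image.2 ⟨(p, q), Finset.mem_product.2 ⟨hp, hq⟩, ?_⟩
    have : p.2 - q.2 ≠ 0 := sub_ne_zero.2 h2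
    simp only
    rw [div_eq_iff this]
    linarith

lemma main (k : ℕ) (P : Finset (ℝ × ℝ)) (hk : 1 ≤ k) (hcard : 2 * (k ^ 2 + 2 * k) ≤ P.card)
    (hgp : GenPos (P : Set (ℝ × ℝ))) :
    ∃ A B : Finset (ℝ × ℝ), A ⊆ P ∧ B ⊆ P ∧ Disjoint A B ∧ A.card = k ∧ B.card = k ∧
      Avoids A B ∧ SeparatedByLine A B := by
  classical
  obtain ⟨θ, hθ⟩ := exists_theta P
  obtain ⟨c, h1, h2, h3⟩ := threshold P (fun p => p.1 + θ * p.2) 1 (k ^ 2 + 2 * k) (by nlinarith)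
    (by omega) (by
      intro v
      rw [Finset.card_le_one]
      intro p hp q hq
      have hp := Finset.mem_filter.1 hp
      have hq := Finset.mem_filter.1 hq
      exact hθ p hp.1 q hq.1 (hp.2.trans hq.2.symm))
  set R := P.filter (fun p => c < p.1 + θ * p.2) with hRdef
  set L := P.filter (fun p => ¬ c < p.1 + θ * p.2) with hLdef
  have hR : ∀ p ∈ R, 0 < XX θ c p := by
    intro p hp
    have := (Finset.mem_filter.1 hp).2
    simp only [XX]; linarith
  have hL : ∀ p ∈ L, XX θ c p < 0 := by
    intro p hp
    have hp := (Finset.mem_filter.1 hp)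
    have := lt_of_le_of_ne (not_lt.1 hp.2) (h3 p hp.1)
    simp only [XX]; linarith
  have hu : R ∪ L = P := Finset.filter_union_filter_not_eq _ _
  have hd : Disjoint R L := Finset.disjoint_filter_filter_not _ _ _
  have hsum : R.card + L.card = P.card := by
    rw [← Finset.card_union_of_disjoint hd, hu]
  have hRP : R ⊆ P := Finset.filter_subset _ _
  have hLP : L ⊆ P := Finset.filter_subset _ _
  have hkk : k ≤ k ^ 2 + 2 * k := by nlinarith
  obtain ⟨t, ⟨⟨s₁, a1, a2⟩, ⟨s₂, a3, a4⟩⟩ | ⟨⟨s₁, a1, a2⟩, ⟨s₂, a3, a4⟩⟩⟩ :=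
    exists_t θ c k hk P R L hgp hR hL hd hu (by omega) (by omega)
  · obtain ⟨A, B, hA, hB, hAc, hBc, hav⟩ := assemble θ c t 1 s₁ (-s₂) (Or.inl rfl) k hk L R
      (fun a ha => by simpa using hL a ha) (fun a ha => by simpa using hR a ha) (by omega)
      (by simpa using a1) (by simpa using a2)
      (by simpa only [neg_mul, one_mul, lt_neg] using a3)
      (by simpa only [neg_mul, one_mul, le_neg] using a4)
    refine ⟨A, B, hA.trans hLP, hB.trans hRP, hd.symm.mono hA hB, hAc, hBc, hav, (1, θ, c), by simp, ?_, ?_⟩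
    · intro a ha
      have := hL a (hA ha)
      simpa [sideVal, XX] using this
    · intro a ha
      have := hR a (hB ha)
      simpa [sideVal, XX] using this
  · obtain ⟨A, B, hA, hB, hAc, hBc, hav⟩ := assemble θ c t (-1) s₁ (-s₂) (Or.inr rfl) k hk R L
      (fun a ha => by simpa using hR a ha) (fun a ha => by simpa using hL a ha) (by omega)
      (by simpa using a1) (by simpa using a2)
      (by simpa only [neg_mul, one_mul, lt_neg] using a3)
      (by simpa only [neg_mul, one_mul, le_neg] using a4)
    refine ⟨A, B, hA.trans hRP, hB.trans hLP, hd.mono hA hB, hAc, hBc, hav, (-1, -θ, -c), by simp, ?_, ?_⟩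
    · intro a ha
      have := hR a (hA ha)
      simp only [sideVal, XX] at this ⊢
      linarith
    · intro a ha
      have := hL a (hB ha)
      simp only [sideVal, XX] at this ⊢
      linarith

end AvoidAux

theorem stmt5 (n : ℕ) (P : Finset (ℝ × ℝ)) (hP : P.card = n)
    (hgp : GenPos (P : Set (ℝ × ℝ))) :
    ∃ A B : Finset (ℝ × ℝ), A ⊆ P ∧ B ⊆ P ∧ Disjoint A B ∧
      A.card = ⌊Real.sqrt ((n : ℝ) / 2 + 1) - 1⌋₊ ∧
      B.card = ⌊Real.sqrt ((n : ℝ) / 2 + 1) - 1⌋₊ ∧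
      Avoids A B ∧ SeparatedByLine A B := by
  set k := ⌊Real.sqrt ((n : ℝ) / 2 + 1) - 1⌋₊ with hk
  by_cases h0 : k = 0
  · rw [h0]
    refine ⟨∅, ∅, by simp, by simp, by simp, by simp, by simp, ?_, (1, 0, 0), by simp, by simp, by simp⟩
    intro a ha
    simp at ha
  · have hk1 : 1 ≤ k := Nat.one_le_iff_ne_zero.2 h0
    apply AvoidAux.main k P hk1 _ hgp
    rw [hP]
    have h1 : (k : ℝ) ≤ Real.sqrt ((n : ℝ) / 2 + 1) - 1 := (Nat.le_floor_iff' h0).1 le_rfl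
    have h2 : ((k : ℝ) + 1) ^ 2 ≤ (n : ℝ) / 2 + 1 := by
      rw [← Real.le_sqrt' (by positivity)]; linarith
    have h3 : (2 * ((k : ℝ) ^ 2 + 2 * k)) ≤ n := by nlinarith
    exact_mod_cast h3
end

section
/- Let M be a geometric matching in which every edge has negative slope or positive slope, with edges ordered by slope, and suppose M satisfies conditions (a), (b), (c) (no two edges parallel; stabbing vertices of an edge stabbing two others lie in the convex hull of those two; in a stabbing chain the middle stabbing vertex lies in the convex hull of the outer edges). Color the upper endpoint of each edge red and the lower endpoint blue. Then the convex hull of the red points and the convex hull of the blue points are disjoint, so the red and blue points can be separated by a line. -/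
/-- Twice the signed area of the triangle `p q r`. -/
def dt (p q r : ℝ × ℝ) : ℝ := (q.1 - p.1) * (r.2 - p.2) - (q.2 - p.2) * (r.1 - p.1)

/-- Cross product of the direction vectors of two edges. -/
def crs (e f : (ℝ × ℝ) × (ℝ × ℝ)) : ℝ :=
  (e.2.1 - e.1.1) * (f.2.2 - f.1.2) - (e.2.2 - e.1.2) * (f.2.1 - f.1.1)

theorem dt_segment (p q x y z : ℝ × ℝ) (a b : ℝ) (hab : a + b = 1) (h : a • x + b • y = z) :
    dt p q z = a * dt p q x + b * dt p q y := by
  subst h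
  have hb : b = 1 - a := by linarith
  subst hb
  simp only [dt, Prod.fst_add, Prod.snd_add, Prod.smul_fst, Prod.smul_snd, smul_eq_mul]
  ring

theorem mem_suppLine {p q : ℝ × ℝ} (hpq : p ≠ q) (s : ℝ × ℝ) :
    s ∈ suppLine p q ↔ dt p q s = 0 := by
  unfold suppLine
  rw [SetLike.mem_coe, mem_affineSpan_pair_iff_exists_lineMap_eq]
  constructor
  · rintro ⟨t, rfl⟩
    simp only [dt, AffineMap.lineMap_apply, vsub_eq_sub, vadd_eq_add, Prod.fst_add, Prod.snd_add,
      Prod.smul_fst, Prod.smul_snd, smul_eq_mul, Prod.fst_sub, Prod.snd_sub]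
    ring
  · intro h
    unfold dt at h
    by_cases h1 : q.1 - p.1 = 0
    · have h2 : q.2 - p.2 ≠ 0 := by
        intro h2
        exact hpq (Prod.ext (by linarith) (by linarith))
      refine ⟨(s.2 - p.2) / (q.2 - p.2), ?_⟩
      have h3 : s.1 - p.1 = 0 := by
        rw [h1] at h
        have : (q.2 - p.2) * (s.1 - p.1) = 0 := by linarith
        exact (mul_eq_zero.mp this).resolve_left h2
      ext
      · simp [AffineMap.lineMap_apply, h1]; linarith
      · simp [AffineMap.lineMap_apply]; field_simp; ring
    · refine ⟨(s.1 - p.1) / (q.1 - p.1), ?_⟩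
      ext
      · simp [AffineMap.lineMap_apply]; field_simp; ring
      · simp [AffineMap.lineMap_apply]; field_simp; linarith

theorem collinear_of_dt {p q r : ℝ × ℝ} (hpq : p ≠ q) (h : dt p q r = 0) :
    Collinear ℝ {p, q, r} := by
  have h1 : r ∈ suppLine p q := (mem_suppLine hpq r).2 h
  have h2 : Collinear ℝ {r, p, q} := collinear_insert_of_mem_affineSpan_pair h1
  have h3 : ({p, q, r} : Set (ℝ × ℝ)) = {r, p, q} := by
    ext x; simp only [Set.mem_insert_iff, Set.mem_singleton_iff]; tauto
  rw [h3]; exact h2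

theorem not_mem_segment {p q x y s : ℝ × ℝ} (h : 0 < dt p q x * dt p q y) (hs : dt p q s = 0) :
    s ∉ segment ℝ x y := by
  rintro ⟨a, b, ha, hb, hab, hz⟩
  have := dt_segment p q x y s a b hab hz
  rw [hs] at this
  rcases pos_and_pos_or_neg_and_neg_of_mul_pos h with ⟨h1, h2⟩ | ⟨h1, h2⟩
  · rcases eq_or_lt_of_le ha with h0 | h0
    · have hb1 : b = 1 := by linarith
      subst hb1; rw [← h0] at this; linarith
    · have := mul_pos h0 h1
      have := mul_nonneg hb h2.le
      linarith
  · rcases eq_or_lt_of_le ha with h0 | h0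
    · have hb1 : b = 1 := by linarith
      subst hb1; rw [← h0] at this; linarith
    · have := mul_pos h0 (neg_pos.2 h1)
      have := mul_nonneg hb (neg_pos.2 h2).le
      linarith

/-- The line of `e₁ e₂` separates the endpoints of `f₁ f₂` and `v` is strictly closer to the line
of `f` than the other endpoint `w`, on the same side: then `v` is the stabbing vertex. -/
theorem stabVertex_of {e₁ e₂ f₁ f₂ v w : ℝ × ℝ}
    (hvw : (v = e₁ ∧ w = e₂) ∨ (v = e₂ ∧ w = e₁))
    (h1 : dt e₁ e₂ f₁ * dt e₁ e₂ f₂ < 0)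
    (h2 : 0 < dt f₁ f₂ v * (dt f₁ f₂ w - dt f₁ f₂ v)) :
    StabVertex e₁ e₂ f₁ f₂ v := by
  have he : e₁ ≠ e₂ := by
    rintro rfl; simp [dt] at h1
  have hf : f₁ ≠ f₂ := by
    rintro rfl
    have := mul_self_nonneg (dt e₁ e₂ f₁)
    linarith
  set A := dt f₁ f₂ v with hA
  set B := dt f₁ f₂ w with hB
  have hAB : B - A ≠ 0 := by
    intro h; rw [h] at h2; simp at h2
  set t : ℝ := A / (B - A) with ht
  have htpos : 0 < t := by
    rw [ht]
    have : A / (B - A) = A * (B - A) / (B - A) ^ 2 := by field_simp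
    rw [this]
    positivity
  have htA : t * (B - A) = A := by rw [ht]; field_simp
  -- the intersection point
  set s : ℝ × ℝ := (v.1 - t * (w.1 - v.1), v.2 - t * (w.2 - v.2)) with hs
  have hsf : dt f₁ f₂ s = 0 := by
    have : dt f₁ f₂ s = A - t * (B - A) := by
      simp only [hs, hA, hB, dt]; ring
    rw [this]; linarith
  have hse : dt e₁ e₂ s = 0 := by
    rcases hvw with ⟨rfl, rfl⟩ | ⟨rfl, rfl⟩ <;> simp only [hs, dt] <;> ring
  have hprod : 0 < dt f₁ f₂ e₁ * dt f₁ f₂ e₂ := by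
    have : 0 < A * B := by nlinarith [mul_self_nonneg A]
    rcases hvw with ⟨rfl, rfl⟩ | ⟨rfl, rfl⟩
    · exact this
    · rw [mul_comm]; exact this
  refine ⟨s, ?_, ?_, not_mem_segment hprod hsf, ?_⟩
  · ext x
    rw [Set.mem_inter_iff, mem_suppLine he, mem_suppLine hf, Set.mem_singleton_iff]
    constructor
    · rintro ⟨hx1, hx2⟩
      -- two linear equations with nonzero determinant
      have hcr : (f₂.1 - f₁.1) * (w.2 - v.2) - (f₂.2 - f₁.2) * (w.1 - v.1) = B - A := by
        simp only [hA, hB, dt]; ring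
      have g1 : (w.1 - v.1) * (x.2 - s.2) - (w.2 - v.2) * (x.1 - s.1) = 0 := by
        rcases hvw with ⟨rfl, rfl⟩ | ⟨rfl, rfl⟩
        · unfold dt at hx1 hse; linarith
        · unfold dt at hx1 hse; linarith
      have g2 : (f₂.1 - f₁.1) * (x.2 - s.2) - (f₂.2 - f₁.2) * (x.1 - s.1) = 0 := by
        unfold dt at hx2 hsf; linarith
      have k1 : (B - A) * (x.1 - s.1) = 0 := by
        rw [← hcr]; linear_combination (w.1 - v.1) * g2 - (f₂.1 - f₁.1) * g1
      have k2 : (B - A) * (x.2 - s.2) = 0 := by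
        rw [← hcr]; linear_combination (w.2 - v.2) * g2 - (f₂.2 - f₁.2) * g1
      have k1' := (mul_eq_zero.mp k1).resolve_left hAB
      have k2' := (mul_eq_zero.mp k2).resolve_left hAB
      exact Prod.ext (by linarith) (by linarith)
    · rintro rfl
      exact ⟨hse, hsf⟩
  · -- s in the segment f
    have hd : dt e₁ e₂ f₁ - dt e₁ e₂ f₂ ≠ 0 := by
      intro h
      have h' : dt e₁ e₂ f₁ = dt e₁ e₂ f₂ := by linarith
      rw [h'] at h1
      have := mul_self_nonneg (dt e₁ e₂ f₂)
      linarith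
    obtain ⟨u, hu⟩ : ∃ u : ℝ, AffineMap.lineMap f₁ f₂ u = s := by
      have := (mem_suppLine hf s).2 hsf
      unfold suppLine at this
      rwa [SetLike.mem_coe, mem_affineSpan_pair_iff_exists_lineMap_eq] at this
    have hu' : (1 - u) • f₁ + u • f₂ = s := by
      rw [← hu, AffineMap.lineMap_apply_module]
    have h0 := dt_segment e₁ e₂ f₁ f₂ s (1 - u) u (by ring) hu'
    rw [hse] at h0
    have hu01 : 0 ≤ u ∧ u ≤ 1 := by
      rcases mul_neg_iff.mp h1 with ⟨p1, p2⟩ | ⟨p1, p2⟩ <;> constructor <;> nlinarith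
    exact ⟨1 - u, u, by linarith [hu01.2], hu01.1, by ring, hu'⟩
  · have hv : dist v s ≤ dist w s := by
      have e1 : dist v s = t * dist w v := by
        rw [dist_eq_norm, dist_eq_norm]
        have : v - s = t • (w - v) := by
          ext <;> simp [hs]
        rw [this, norm_smul, Real.norm_of_nonneg htpos.le]
      have e2 : dist w s = (1 + t) * dist w v := by
        rw [dist_eq_norm, dist_eq_norm]
        have : w - s = (1 + t) • (w - v) := by
          ext <;> simp [hs] <;> ring
        rw [this, norm_smul, Real.norm_of_nonneg (by linarith)]
      rw [e1, e2]
      have := dist_nonneg (x := w) (y := v)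
      nlinarith
    rcases hvw with ⟨rfl, rfl⟩ | ⟨rfl, rfl⟩
    · exact Or.inl ⟨rfl, hv⟩
    · exact Or.inr ⟨rfl, hv⟩

theorem StabVertex.segStabs {e₁ e₂ f₁ f₂ v : ℝ × ℝ} (h : StabVertex e₁ e₂ f₁ f₂ v) :
    SegStabs e₁ e₂ f₁ f₂ := by
  obtain ⟨s, h1, h2, h3, -⟩ := h
  exact ⟨s, h1, h2, h3⟩

theorem sep_of_not_parallel {e₁ e₂ f₁ f₂ : ℝ × ℝ} (he : e₁ ≠ e₂) (hf : f₁ ≠ f₂)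
    (n1 : dt e₁ e₂ f₁ ≠ 0) (n2 : dt e₁ e₂ f₂ ≠ 0) (n3 : dt f₁ f₂ e₁ ≠ 0) (n4 : dt f₁ f₂ e₂ ≠ 0)
    (h : ¬ SegParallel e₁ e₂ f₁ f₂) :
    dt e₁ e₂ f₁ * dt e₁ e₂ f₂ < 0 ∨ dt f₁ f₂ e₁ * dt f₁ f₂ e₂ < 0 := by
  by_contra hcon
  rw [not_or, not_lt, not_lt] at hcon
  apply h
  rintro s ⟨hs1, hs2⟩
  rw [mem_suppLine he] at hs1
  rw [mem_suppLine hf] at hs2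
  exact ⟨not_mem_segment (lt_of_le_of_ne hcon.2 (mul_ne_zero n3 n4).symm) hs2,
    not_mem_segment (lt_of_le_of_ne hcon.1 (mul_ne_zero n1 n2).symm) hs1⟩

/-- A point of the hull of four points does not see the other three strictly on one side of the
line through itself and one of them. -/
theorem hull_contra (σ : ℝ) {a b c d v : ℝ × ℝ} (p x : ℝ × ℝ)
    (hv : v ∈ convexHull ℝ ({a, b, c, d} : Set (ℝ × ℝ)))
    (ha : a = p ∨ 0 < σ * dt v p a) (hb : b = p ∨ 0 < σ * dt v p b)
    (hc : c = p ∨ 0 < σ * dt v p c) (hd : d = p ∨ 0 < σ * dt v p d)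
    (hx : 0 < σ * dt v p x) : False := by
  have hconv : Convex ℝ {y : ℝ × ℝ | y = p ∨ 0 < σ * dt v p y} := by
    intro y hy z hz α β hα hβ hαβ
    have key := dt_segment v p y z _ α β hαβ rfl
    have hpp : dt v p p = 0 := by unfold dt; ring
    simp only [Set.mem_ofPred_eq] at hy hz ⊢
    rw [key]
    rcases hy with rfl | hy <;> rcases hz with rfl | hz
    · left; rw [← add_smul, hαβ, one_smul]
    · rcases eq_or_lt_of_le hβ with h0 | h0
      · left
        have : α = 1 := by linarith
        rw [← h0, this]; simp
      · right; rw [hpp]; have := mul_pos h0 hz; linarith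
    · rcases eq_or_lt_of_le hα with h0 | h0
      · left
        have : β = 1 := by linarith
        rw [← h0, this]; simp
      · right; rw [hpp]; have := mul_pos h0 hy; linarith
    · right
      rcases eq_or_lt_of_le hα with h0 | h0
      · have : β = 1 := by linarith
        rw [← h0, this]; linarith
      · have := mul_pos h0 hy
        have := mul_nonneg hβ hz.le
        linarith
  have hsub : convexHull ℝ ({a, b, c, d} : Set (ℝ × ℝ)) ⊆ {y | y = p ∨ 0 < σ * dt v p y} := by
    apply convexHull_min _ hconv
    intro y hy
    simp only [Set.mem_insert_iff, Set.mem_singleton_iff] at hy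
    rcases hy with rfl | rfl | rfl | rfl <;> assumption
  rcases hsub hv with h | h
  · subst h
    have : dt v v x = 0 := by unfold dt; ring
    rw [this] at hx; simp at hx
  · have : dt v p v = 0 := by unfold dt; ring
    rw [this] at h; simp at h

/-- A weakly separating line through a red and a blue point can be perturbed. -/
theorem perturb (σ : ℝ) (r b x : ℝ × ℝ) (R B : Finset (ℝ × ℝ)) (hx : dt r b x ≠ 0)
    (hR : ∀ p ∈ R, p = r ∨ 0 < σ * dt r b p) (hB : ∀ p ∈ B, p = b ∨ σ * dt r b p < 0) :
    ∃ l : ℝ × ℝ × ℝ, (∀ p ∈ R, 0 < sideVal l p) ∧ (∀ p ∈ B, sideVal l p < 0) := by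
  have hrb : 0 < (r.1 - b.1) ^ 2 + (r.2 - b.2) ^ 2 := by
    by_contra hcon
    have h1 : r.1 - b.1 = 0 := by nlinarith [sq_nonneg (r.1 - b.1), sq_nonneg (r.2 - b.2)]
    have h2 : r.2 - b.2 = 0 := by nlinarith [sq_nonneg (r.1 - b.1), sq_nonneg (r.2 - b.2)]
    apply hx
    unfold dt
    have h1' : b.1 - r.1 = 0 := by linarith
    have h2' : b.2 - r.2 = 0 := by linarith
    rw [h1', h2']; ring
  let K : ℝ × ℝ → ℝ := fun p =>
    (r.1 - b.1) * (p.1 - (r.1 + b.1) / 2) + (r.2 - b.2) * (p.2 - (r.2 + b.2) / 2)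
  have hKr : 0 < K r := by simp only [K]; nlinarith
  have hKb : K b < 0 := by simp only [K]; nlinarith
  have hcont : ∀ p, Filter.Tendsto (fun ε : ℝ => σ * dt r b p + ε * K p)
      (nhdsWithin 0 (Set.Ioi 0)) (nhds (σ * dt r b p)) := by
    intro p
    have : Continuous (fun ε : ℝ => σ * dt r b p + ε * K p) := by fun_prop
    have h := this.tendsto 0
    simp only [zero_mul, add_zero] at h
    exact h.mono_left nhdsWithin_le_nhds
  have hpos : ∀ᶠ ε : ℝ in nhdsWithin 0 (Set.Ioi 0), 0 < ε := self_mem_nhdsWithin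
  have e1 : ∀ᶠ ε : ℝ in nhdsWithin 0 (Set.Ioi 0), ∀ p ∈ R, 0 < σ * dt r b p + ε * K p := by
    rw [Filter.eventually_all_finset]
    intro p hp
    rcases hR p hp with rfl | h
    · filter_upwards [hpos] with ε hε
      have : dt p b p = 0 := by unfold dt; ring
      rw [this]; have := mul_pos hε hKr; linarith
    · exact (hcont p).eventually_const_lt h
  have e2 : ∀ᶠ ε : ℝ in nhdsWithin 0 (Set.Ioi 0), ∀ p ∈ B, σ * dt r b p + ε * K p < 0 := by
    rw [Filter.eventually_all_finset]
    intro p hp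
    rcases hB p hp with rfl | h
    · filter_upwards [hpos] with ε hε
      have : dt r p p = 0 := by unfold dt; ring
      rw [this]; nlinarith
    · exact (hcont p).eventually_lt_const h
  obtain ⟨ε, h1, h2⟩ := (e1.and e2).exists
  refine ⟨(σ * (-(b.2 - r.2)) + ε * (r.1 - b.1), σ * (b.1 - r.1) + ε * (r.2 - b.2),
    σ * ((b.1 - r.1) * r.2 - (b.2 - r.2) * r.1) + ε * ((r.1 - b.1) * ((r.1 + b.1) / 2) +
      (r.2 - b.2) * ((r.2 + b.2) / 2))), ?_, ?_⟩
  · intro p hp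
    have := h1 p hp
    simp only [sideVal, dt, K] at this ⊢
    linarith
  · intro p hp
    have := h2 p hp
    simp only [sideVal, dt, K] at this ⊢
    linarith

theorem perturb3 (σ : ℝ) (r b x r0 r1 r2 b0 b1 b2 : ℝ × ℝ) (hx : dt r b x ≠ 0)
    (h0 : r0 = r ∨ 0 < σ * dt r b r0) (h1 : r1 = r ∨ 0 < σ * dt r b r1)
    (h2 : r2 = r ∨ 0 < σ * dt r b r2)
    (k0 : b0 = b ∨ σ * dt r b b0 < 0) (k1 : b1 = b ∨ σ * dt r b b1 < 0)
    (k2 : b2 = b ∨ σ * dt r b b2 < 0) :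
    ∃ l : ℝ × ℝ × ℝ, (0 < sideVal l r0 ∧ 0 < sideVal l r1 ∧ 0 < sideVal l r2) ∧
      (sideVal l b0 < 0 ∧ sideVal l b1 < 0 ∧ sideVal l b2 < 0) := by
  obtain ⟨l, hl1, hl2⟩ := perturb σ r b x {r0, r1, r2} {b0, b1, b2} hx
    (by intro p hp; simp only [Finset.mem_insert, Finset.mem_singleton] at hp
        rcases hp with rfl | rfl | rfl <;> assumption)
    (by intro p hp; simp only [Finset.mem_insert, Finset.mem_singleton] at hp
        rcases hp with rfl | rfl | rfl <;> assumption)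
  exact ⟨l, ⟨hl1 _ (by simp), hl1 _ (by simp), hl1 _ (by simp)⟩,
    ⟨hl2 _ (by simp), hl2 _ (by simp), hl2 _ (by simp)⟩⟩
set_option maxHeartbeats 4000000 in
/-- The propositional core of the three-edge case. A variable such as `b0r0b1` says that the
triple of points is positively oriented. -/
theorem core3 (b0r0b1 b0r0r1 b0r0b2 b0r0r2 b0b1r1 b0b1b2 b0b1r2 b0r1b2 b0r1r2 b0b2r2 r0b1r1 r0b1b2 r0b1r2 r0r1b2 r0r1r2 r0b2r2 b1r1b2 b1r1r2 b1b2r2 r1b2r2 : Prop)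
    (a01 : (¬ b0r0b1 ∧ b0r0r1) ∨ (b0b1r1 ∧ ¬ r0b1r1))
    (d01 : ¬ b0r0b1 ∨ b0r0r1) (d10 : b0b1r1 ∨ ¬ r0b1r1)
    (a02 : (¬ b0r0b2 ∧ b0r0r2) ∨ (b0b2r2 ∧ ¬ r0b2r2))
    (d02 : ¬ b0r0b2 ∨ b0r0r2) (d20 : b0b2r2 ∨ ¬ r0b2r2)
    (a12 : (¬ b1r1b2 ∧ b1r1r2) ∨ (b1b2r2 ∧ ¬ r1b2r2))
    (d12 : ¬ b1r1b2 ∨ b1r1r2) (d21 : b1b2r2 ∨ ¬ r1b2r2)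
    (h0 : ¬ b0r0b1 ∨ b0r0b2 ∨ ¬ b0b1b2 ∨ r0b1b2 ∨ False)
    (h1 : ¬ b0b1b2 ∨ b0b1r2 ∨ ¬ b0b2r2 ∨ b1b2r2 ∨ False)
    (h2 : b0r0b1 ∨ ¬ b0r0b2 ∨ b0b1b2 ∨ ¬ r0b1b2 ∨ False)
    (h3 : ¬ r0r1b2 ∨ r0r1r2 ∨ ¬ r0b2r2 ∨ r1b2r2 ∨ False)
    (h4 : ¬ b0b1r1 ∨ b0b1b2 ∨ ¬ b0r1b2 ∨ b1r1b2 ∨ False)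
    (h5 : ¬ b0r0r1 ∨ b0r0r2 ∨ ¬ b0r1r2 ∨ r0r1r2 ∨ False)
    (h6 : b0b1b2 ∨ ¬ b0b1r2 ∨ b0b2r2 ∨ ¬ b1b2r2 ∨ False)
    (h7 : b0r0b1 ∨ ¬ b0r0r2 ∨ b0b1r2 ∨ ¬ r0b1r2 ∨ False)
    (h8 : r0r1b2 ∨ ¬ r0r1r2 ∨ r0b2r2 ∨ ¬ r1b2r2 ∨ False)
    (h9 : r0b1r1 ∨ ¬ r0b1b2 ∨ ¬ r0b1r2 ∨ b1r1b2 ∨ ¬ b1r1r2 ∨ ¬ b1b2r2 ∨ False)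
    (h10 : b0r0b2 ∨ b0b1b2 ∨ ¬ b0b2r2 ∨ r0b1b2 ∨ r0b2r2 ∨ ¬ b1b2r2 ∨ False)
    (h11 : ¬ b0r0r2 ∨ b0b1r2 ∨ ¬ b0b2r2 ∨ r0b1r2 ∨ r0b2r2 ∨ b1b2r2 ∨ False)
    (h12 : ¬ b0r0b1 ∨ ¬ b0r0r1 ∨ ¬ b0b1r1 ∨ r0b1r1 ∨ ¬ r0b1b2 ∨ ¬ r0b1r2 ∨ b1r1b2 ∨ ¬ b1r1r2 ∨ b1b2r2 ∨ r1b2r2 ∨ False)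
    (h13 : ¬ b0r0b1 ∨ ¬ b0r0r1 ∨ ¬ b0b1r1 ∨ b0b1b2 ∨ r0b1r1 ∨ r0b1b2 ∨ b1r1b2 ∨ ¬ b1r1r2 ∨ b1b2r2 ∨ r1b2r2 ∨ False)
    (h14 : b0r0b1 ∨ b0r0r1 ∨ ¬ b0b1r1 ∨ r0b1r1 ∨ r0r1b2 ∨ r0r1r2 ∨ b1r1b2 ∨ ¬ b1r1r2 ∨ ¬ b1b2r2 ∨ ¬ r1b2r2 ∨ False)
    (h15 : b0r0b1 ∨ b0r0r1 ∨ ¬ b0b1r1 ∨ ¬ b0r1b2 ∨ r0b1r1 ∨ ¬ r0r1b2 ∨ b1r1b2 ∨ ¬ b1r1r2 ∨ ¬ b1b2r2 ∨ ¬ r1b2r2 ∨ False)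
    (h16 : b0r0b1 ∨ b0r0r1 ∨ ¬ b0b1r1 ∨ ¬ b0b1r2 ∨ r0b1r1 ∨ ¬ r0b1r2 ∨ b1r1b2 ∨ ¬ b1r1r2 ∨ b1b2r2 ∨ r1b2r2 ∨ False)
    (h17 : b0r0b1 ∨ b0r0r1 ∨ b0r0b2 ∨ ¬ b0r0r2 ∨ ¬ b0b1r1 ∨ ¬ b0b1b2 ∨ ¬ b0r1b2 ∨ b0b2r2 ∨ r0b1r1 ∨ r0b2r2 ∨ False)
    (h18 : b0r0b1 ∨ b0r0r1 ∨ b0r0b2 ∨ ¬ b0r0r2 ∨ ¬ b0b1r1 ∨ b0b1r2 ∨ b0r1r2 ∨ b0b2r2 ∨ r0b1r1 ∨ r0b2r2 ∨ False)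
    (h19 : b0r0b1 ∨ b0r0r1 ∨ b0r0b2 ∨ ¬ b0r0r2 ∨ ¬ b0b1r1 ∨ b0r1b2 ∨ b0r1r2 ∨ b0b2r2 ∨ r0b1r1 ∨ r0b2r2 ∨ False)
    (h20 : ¬ b0r0b1 ∨ ¬ b0r0r1 ∨ b0r0b2 ∨ ¬ b0r0r2 ∨ ¬ b0b1r1 ∨ ¬ b0b1b2 ∨ ¬ b0r1b2 ∨ b0b2r2 ∨ r0b1r1 ∨ r0b2r2 ∨ False)
    (h21 : ¬ b0r0b1 ∨ ¬ b0r0r1 ∨ b0r0b2 ∨ ¬ b0r0r2 ∨ ¬ b0b1r1 ∨ ¬ b0b1b2 ∨ ¬ b0b1r2 ∨ b0b2r2 ∨ r0b1r1 ∨ r0b2r2 ∨ False)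
    (h22 : ¬ b0r0b1 ∨ ¬ b0r0r1 ∨ b0r0b2 ∨ ¬ b0r0r2 ∨ ¬ b0b1r1 ∨ b0r1b2 ∨ b0r1r2 ∨ b0b2r2 ∨ r0b1r1 ∨ r0b2r2 ∨ False)
    (h23 : b0r0b1 ∨ b0r0r1 ∨ b0r0b2 ∨ ¬ b0r0r2 ∨ ¬ b0b1r1 ∨ ¬ b0b2r2 ∨ r0b1r1 ∨ r0b1b2 ∨ r0r1b2 ∨ ¬ r0b2r2 ∨ False)
    (h24 : b0r0b1 ∨ b0r0r1 ∨ b0r0b2 ∨ ¬ b0r0r2 ∨ ¬ b0b1r1 ∨ ¬ b0b2r2 ∨ r0b1r1 ∨ ¬ r0r1b2 ∨ ¬ r0r1r2 ∨ ¬ r0b2r2 ∨ False)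
    (h25 : ¬ b0r0b1 ∨ ¬ b0r0r1 ∨ b0r0b2 ∨ ¬ b0r0r2 ∨ ¬ b0b1r1 ∨ ¬ b0b2r2 ∨ r0b1r1 ∨ r0b1b2 ∨ r0r1b2 ∨ ¬ r0b2r2 ∨ False)
    (h26 : ¬ b0r0b1 ∨ ¬ b0r0r1 ∨ b0r0b2 ∨ ¬ b0r0r2 ∨ ¬ b0b1r1 ∨ ¬ b0b2r2 ∨ r0b1r1 ∨ ¬ r0r1b2 ∨ ¬ r0r1r2 ∨ ¬ r0b2r2 ∨ False)
    (h27 : ¬ b0r0b2 ∨ ¬ b0r0r2 ∨ ¬ b0b1b2 ∨ ¬ b0r1b2 ∨ ¬ b0b2r2 ∨ r0b2r2 ∨ b1r1b2 ∨ ¬ b1r1r2 ∨ b1b2r2 ∨ r1b2r2 ∨ False)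
    (h28 : ¬ b0r0b2 ∨ ¬ b0r0r2 ∨ ¬ b0b1b2 ∨ ¬ b0b2r2 ∨ ¬ r0b1b2 ∨ r0b2r2 ∨ b1r1b2 ∨ ¬ b1r1r2 ∨ b1b2r2 ∨ r1b2r2 ∨ False)
    (h29 : ¬ b0r0b2 ∨ ¬ b0r0r2 ∨ b0r1b2 ∨ ¬ b0b2r2 ∨ r0r1b2 ∨ r0b2r2 ∨ b1r1b2 ∨ ¬ b1r1r2 ∨ b1b2r2 ∨ r1b2r2 ∨ False)
    (h30 : ¬ b0r0b2 ∨ ¬ b0r0r2 ∨ ¬ b0b2r2 ∨ r0b1b2 ∨ r0r1b2 ∨ r0b2r2 ∨ b1r1b2 ∨ ¬ b1r1r2 ∨ ¬ b1b2r2 ∨ ¬ r1b2r2 ∨ False)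
    (h31 : ¬ b0r0b2 ∨ ¬ b0r0r2 ∨ ¬ b0b1b2 ∨ ¬ b0b2r2 ∨ ¬ r0b1b2 ∨ r0b2r2 ∨ b1r1b2 ∨ ¬ b1r1r2 ∨ ¬ b1b2r2 ∨ ¬ r1b2r2 ∨ False)
    (h32 : b0r0b2 ∨ b0r0r2 ∨ b0b1r2 ∨ b0r1r2 ∨ ¬ b0b2r2 ∨ r0b2r2 ∨ b1r1b2 ∨ ¬ b1r1r2 ∨ b1b2r2 ∨ r1b2r2 ∨ False)
    (h33 : b0r0b2 ∨ b0r0r2 ∨ ¬ b0r1r2 ∨ ¬ b0b2r2 ∨ ¬ r0r1r2 ∨ r0b2r2 ∨ b1r1b2 ∨ ¬ b1r1r2 ∨ b1b2r2 ∨ r1b2r2 ∨ False)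
    (h34 : b0r0b2 ∨ b0r0r2 ∨ b0b1r2 ∨ b0r1r2 ∨ ¬ b0b2r2 ∨ r0b2r2 ∨ b1r1b2 ∨ ¬ b1r1r2 ∨ ¬ b1b2r2 ∨ ¬ r1b2r2 ∨ False)
    (h35 : b0r0b2 ∨ b0r0r2 ∨ ¬ b0r1r2 ∨ ¬ b0b2r2 ∨ ¬ r0r1r2 ∨ r0b2r2 ∨ b1r1b2 ∨ ¬ b1r1r2 ∨ ¬ b1b2r2 ∨ ¬ r1b2r2 ∨ False)
    (h36 : b0r0b1 ∨ ¬ b0r0r1 ∨ ¬ b0r0b2 ∨ ¬ b0r0r2 ∨ b0b1r1 ∨ ¬ b0r1b2 ∨ ¬ b0r1r2 ∨ ¬ b0b2r2 ∨ r0b1r1 ∨ r0b2r2 ∨ False)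
    (h37 : ¬ b0r0b1 ∨ ¬ b0r0r1 ∨ ¬ b0b1r1 ∨ b0b1b2 ∨ b0b1r2 ∨ r0b1r1 ∨ ¬ b1r1b2 ∨ ¬ b1r1r2 ∨ ¬ b1b2r2 ∨ r1b2r2 ∨ False)
    (h38 : b0r0b1 ∨ ¬ b0r0r1 ∨ b0r0b2 ∨ ¬ b0r0r2 ∨ False)
    (h39 : ¬ b0r0b1 ∨ r0b1r1 ∨ ¬ r0b1b2 ∨ r0b1r2 ∨ False)
    (h40 : ¬ b0r0b2 ∨ r0b1b2 ∨ ¬ r0r1b2 ∨ r0b2r2 ∨ False)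
    (h41 : b0r0b2 ∨ ¬ r0b1b2 ∨ r0r1b2 ∨ ¬ r0b2r2 ∨ False)
    (h42 : b0r0r1 ∨ ¬ b0b1r1 ∨ b0r1b2 ∨ ¬ b0r1r2 ∨ False)
    (h43 : ¬ b0r0r1 ∨ b0b1r1 ∨ ¬ b0r1b2 ∨ b0r1r2 ∨ False)
    (h44 : b0r1b2 ∨ ¬ r0r1b2 ∨ b1r1b2 ∨ ¬ r1b2r2 ∨ False)
    (h45 : b0r0r2 ∨ ¬ b0b1r2 ∨ b0r1r2 ∨ ¬ b0b2r2 ∨ False)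
    (h46 : ¬ b0r0r2 ∨ b0b1r2 ∨ ¬ b0r1r2 ∨ b0b2r2 ∨ False)
    (h47 : ¬ b0b1r2 ∨ r0b1r2 ∨ ¬ b1r1r2 ∨ b1b2r2 ∨ False)
    (h48 : ¬ b0b2r2 ∨ r0b2r2 ∨ ¬ b1b2r2 ∨ r1b2r2 ∨ False)
    : False := by
  grind (splits := 100)

theorem orp {d : ℝ} {C : Prop} (n : d ≠ 0) (h : d < 0 → C) : 0 < d ∨ C := by
  rcases lt_or_gt_of_ne n with h1 | h1
  · exact Or.inr (h h1)
  · exact Or.inl h1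

theorem orn {d : ℝ} {C : Prop} (h : 0 < d → C) : ¬ 0 < d ∨ C := by
  by_cases h1 : 0 < d
  · exact Or.inr (h h1)
  · exact Or.inl h1

theorem aux_a {x y z w : ℝ} (h1 : x < y) (h2 : w < z) (h : x * y < 0 ∨ z * w < 0) :
    (¬ 0 < x ∧ 0 < y) ∨ (0 < z ∧ ¬ 0 < w) := by
  rcases h with h | h
  · left
    rcases mul_neg_iff.mp h with ⟨p, q⟩ | ⟨p, q⟩
    · linarith
    · exact ⟨not_lt.2 p.le, q⟩
  · right
    rcases mul_neg_iff.mp h with ⟨p, q⟩ | ⟨p, q⟩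
    · exact ⟨p, not_lt.2 q.le⟩
    · linarith

theorem aux_d {x y : ℝ} (h : x < y) : ¬ 0 < x ∨ 0 < y := by
  by_cases h1 : 0 < x
  · exact Or.inr (h1.trans h)
  · exact Or.inl h1

/-- Condition (b) in terms of orientations. -/
def CondB (e₁ e₂ f₁ f₂ g₁ g₂ : ℝ × ℝ) : Prop :=
  ∀ v w, ((v = e₁ ∧ w = e₂) ∨ (v = e₂ ∧ w = e₁)) → dt e₁ e₂ f₁ * dt e₁ e₂ f₂ < 0 →
    0 < dt f₁ f₂ v * (dt f₁ f₂ w - dt f₁ f₂ v) → dt e₁ e₂ g₁ * dt e₁ e₂ g₂ < 0 →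
    0 < dt g₁ g₂ e₁ * dt g₁ g₂ e₂ → v ∈ convexHull ℝ ({f₁, f₂, g₁, g₂} : Set (ℝ × ℝ))

/-- Condition (c) in terms of orientations: `g` stabs `e`, `e` stabs `f`. -/
def CondC (g₁ g₂ e₁ e₂ f₁ f₂ : ℝ × ℝ) : Prop :=
  ∀ v w, ((v = e₁ ∧ w = e₂) ∨ (v = e₂ ∧ w = e₁)) → dt e₁ e₂ f₁ * dt e₁ e₂ f₂ < 0 →
    0 < dt f₁ f₂ v * (dt f₁ f₂ w - dt f₁ f₂ v) → dt g₁ g₂ e₁ * dt g₁ g₂ e₂ < 0 →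
    0 < dt e₁ e₂ g₁ * dt e₁ e₂ g₂ → v ∈ convexHull ℝ ({g₁, g₂, f₁, f₂} : Set (ℝ × ℝ))

set_option maxHeartbeats 4000000 in
/-- Three edges sorted by slope can be separated. -/
theorem three (b0 r0 b1 r1 b2 r2 : ℝ × ℝ)
    (nb0r0b1 : dt b0 r0 b1 ≠ 0)
    (nb0r0r1 : dt b0 r0 r1 ≠ 0)
    (nb0r0b2 : dt b0 r0 b2 ≠ 0)
    (nb0r0r2 : dt b0 r0 r2 ≠ 0)
    (nb0b1r1 : dt b1 r1 b0 ≠ 0)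
    (nb0b1b2 : dt b0 b1 b2 ≠ 0)
    (nb0b1r2 : dt b0 b1 r2 ≠ 0)
    (nb0r1b2 : dt b0 r1 b2 ≠ 0)
    (nb0r1r2 : dt b0 r1 r2 ≠ 0)
    (nb0b2r2 : dt b2 r2 b0 ≠ 0)
    (nr0b1r1 : dt b1 r1 r0 ≠ 0)
    (nr0b1b2 : dt r0 b1 b2 ≠ 0)
    (nr0b1r2 : dt r0 b1 r2 ≠ 0)
    (nr0r1b2 : dt r0 r1 b2 ≠ 0)
    (nr0r1r2 : dt r0 r1 r2 ≠ 0)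
    (nr0b2r2 : dt b2 r2 r0 ≠ 0)
    (nb1r1b2 : dt b1 r1 b2 ≠ 0)
    (nb1r1r2 : dt b1 r1 r2 ≠ 0)
    (nb1b2r2 : dt b2 r2 b1 ≠ 0)
    (nr1b2r2 : dt b2 r2 r1 ≠ 0)
    (D01 : dt b0 r0 b1 < dt b0 r0 r1) (D10 : dt b1 r1 r0 < dt b1 r1 b0)
    (a01 : dt b0 r0 b1 * dt b0 r0 r1 < 0 ∨ dt b1 r1 b0 * dt b1 r1 r0 < 0)
    (D02 : dt b0 r0 b2 < dt b0 r0 r2) (D20 : dt b2 r2 r0 < dt b2 r2 b0)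
    (a02 : dt b0 r0 b2 * dt b0 r0 r2 < 0 ∨ dt b2 r2 b0 * dt b2 r2 r0 < 0)
    (D12 : dt b1 r1 b2 < dt b1 r1 r2) (D21 : dt b2 r2 r1 < dt b2 r2 b1)
    (a12 : dt b1 r1 b2 * dt b1 r1 r2 < 0 ∨ dt b2 r2 b1 * dt b2 r2 r1 < 0)
    (B102 : CondB b1 r1 b0 r0 b2 r2)
    (B120 : CondB b1 r1 b2 r2 b0 r0)
    (C102 : CondC b1 r1 b0 r0 b2 r2)
    (C120 : CondC b1 r1 b2 r2 b0 r0)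
    (C201 : CondC b2 r2 b0 r0 b1 r1)
    (C210 : CondC b2 r2 b1 r1 b0 r0)
    : ∃ l : ℝ × ℝ × ℝ, (0 < sideVal l r0 ∧ 0 < sideVal l r1 ∧ 0 < sideVal l r2) ∧
      (sideVal l b0 < 0 ∧ sideVal l b1 < 0 ∧ sideVal l b2 < 0) := by
  by_contra hno
  apply core3 (0 < dt b0 r0 b1)
    (0 < dt b0 r0 r1)
    (0 < dt b0 r0 b2)
    (0 < dt b0 r0 r2)
    (0 < dt b1 r1 b0)
    (0 < dt b0 b1 b2)
    (0 < dt b0 b1 r2)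
    (0 < dt b0 r1 b2)
    (0 < dt b0 r1 r2)
    (0 < dt b2 r2 b0)
    (0 < dt b1 r1 r0)
    (0 < dt r0 b1 b2)
    (0 < dt r0 b1 r2)
    (0 < dt r0 r1 b2)
    (0 < dt r0 r1 r2)
    (0 < dt b2 r2 r0)
    (0 < dt b1 r1 b2)
    (0 < dt b1 r1 r2)
    (0 < dt b2 r2 b1)
    (0 < dt b2 r2 r1)
  · exact aux_a D01 D10 a01
  · exact aux_d D01
  · exact (aux_d D10).symm
  · exact aux_a D02 D20 a02
  · exact aux_d D02
  · exact (aux_d D20).symm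
  · exact aux_a D12 D21 a12
  · exact aux_d D12
  · exact (aux_d D21).symm
  · refine orn fun kb0r0b1 => orp nb0r0b2 fun kb0r0b2 => orn fun kb0b1b2 => orp nr0b1b2 fun kr0b1b2 => ?_
    unfold dt at kb0r0b1 kb0r0b2 kb0b1b2 kr0b1b2
    linarith
  · refine orn fun kb0b1b2 => orp nb0b1r2 fun kb0b1r2 => orn fun kb0b2r2 => orp nb1b2r2 fun kb1b2r2 => ?_
    unfold dt at kb0b1b2 kb0b1r2 kb0b2r2 kb1b2r2
    linarith
  · refine orp nb0r0b1 fun kb0r0b1 => orn fun kb0r0b2 => orp nb0b1b2 fun kb0b1b2 => orn fun kr0b1b2 => ?_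
    unfold dt at kb0r0b1 kb0r0b2 kb0b1b2 kr0b1b2
    linarith
  · refine orn fun kr0r1b2 => orp nr0r1r2 fun kr0r1r2 => orn fun kr0b2r2 => orp nr1b2r2 fun kr1b2r2 => ?_
    unfold dt at kr0r1b2 kr0r1r2 kr0b2r2 kr1b2r2
    linarith
  · refine orn fun kb0b1r1 => orp nb0b1b2 fun kb0b1b2 => orn fun kb0r1b2 => orp nb1r1b2 fun kb1r1b2 => ?_
    unfold dt at kb0b1r1 kb0b1b2 kb0r1b2 kb1r1b2
    linarith
  · refine orn fun kb0r0r1 => orp nb0r0r2 fun kb0r0r2 => orn fun kb0r1r2 => orp nr0r1r2 fun kr0r1r2 => ?_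
    unfold dt at kb0r0r1 kb0r0r2 kb0r1r2 kr0r1r2
    linarith
  · refine orp nb0b1b2 fun kb0b1b2 => orn fun kb0b1r2 => orp nb0b2r2 fun kb0b2r2 => orn fun kb1b2r2 => ?_
    unfold dt at kb0b1b2 kb0b1r2 kb0b2r2 kb1b2r2
    linarith
  · refine orp nb0r0b1 fun kb0r0b1 => orn fun kb0r0r2 => orp nb0b1r2 fun kb0b1r2 => orn fun kr0b1r2 => ?_
    unfold dt at kb0r0b1 kb0r0r2 kb0b1r2 kr0b1r2
    linarith
  · refine orp nr0r1b2 fun kr0r1b2 => orn fun kr0r1r2 => orp nr0b2r2 fun kr0b2r2 => orn fun kr1b2r2 => ?_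
    unfold dt at kr0r1b2 kr0r1r2 kr0b2r2 kr1b2r2
    linarith
  · refine orp nr0b1r1 fun kr0b1r1 => orn fun kr0b1b2 => orn fun kr0b1r2 => orp nb1r1b2 fun kb1r1b2 => orn fun kb1r1r2 => orn fun kb1b2r2 => ?_
    have h : -dt b1 r1 r0 * dt b2 r2 b1 + dt r0 b1 b2 * dt b1 r1 r2 - dt r0 b1 r2 * dt b1 r1 b2 = 0 := by
      unfold dt; ring
    linarith [mul_pos (neg_pos.2 kr0b1r1) kb1b2r2, mul_pos kr0b1b2 kb1r1r2, mul_pos kr0b1r2 (neg_pos.2 kb1r1b2)]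
  · refine orp nb0r0b2 fun kb0r0b2 => orp nb0b1b2 fun kb0b1b2 => orn fun kb0b2r2 => orp nr0b1b2 fun kr0b1b2 => orp nr0b2r2 fun kr0b2r2 => orn fun kb1b2r2 => ?_
    have h : -dt b0 r0 b2 * dt b2 r2 b1 + dt b0 b1 b2 * dt b2 r2 r0 - dt b2 r2 b0 * dt r0 b1 b2 = 0 := by
      unfold dt; ring
    linarith [mul_pos (neg_pos.2 kb0r0b2) kb1b2r2, mul_pos (neg_pos.2 kb0b1b2) (neg_pos.2 kr0b2r2), mul_pos kb0b2r2 (neg_pos.2 kr0b1b2)]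
  · refine orn fun kb0r0r2 => orp nb0b1r2 fun kb0b1r2 => orn fun kb0b2r2 => orp nr0b1r2 fun kr0b1r2 => orp nr0b2r2 fun kr0b2r2 => orp nb1b2r2 fun kb1b2r2 => ?_
    have h : dt b0 r0 r2 * dt b2 r2 b1 - dt b0 b1 r2 * dt b2 r2 r0 + dt b2 r2 b0 * dt r0 b1 r2 = 0 := by
      unfold dt; ring
    linarith [mul_pos kb0r0r2 (neg_pos.2 kb1b2r2), mul_pos (neg_pos.2 kb0b1r2) (neg_pos.2 kr0b2r2), mul_pos kb0b2r2 (neg_pos.2 kr0b1r2)]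
  · refine orn fun kb0r0b1 => orn fun kb0r0r1 => orn fun kb0b1r1 => orp nr0b1r1 fun kr0b1r1 => orn fun kr0b1b2 => orn fun kr0b1r2 => orp nb1r1b2 fun kb1r1b2 => orn fun kb1r1r2 => orp nb1b2r2 fun kb1b2r2 => orp nr1b2r2 fun kr1b2r2 => ?_
    have hv := B102 b1 r1 (Or.inl ⟨rfl, rfl⟩) (mul_neg_of_pos_of_neg kb0b1r1 kr0b1r1)
      (mul_pos kb0r0b1 (by linarith)) (mul_neg_of_neg_of_pos kb1r1b2 kb1r1r2) (mul_pos_of_neg_of_neg kb1b2r2 kr1b2r2)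
    exact hull_contra (-1) r0 b0 hv (Or.inr (by unfold dt at kb0r0b1 ⊢; linarith))
      (Or.inl rfl)
      (Or.inr (by unfold dt at kr0b1b2 ⊢; linarith))
      (Or.inr (by unfold dt at kr0b1r2 ⊢; linarith))
      (by unfold dt at kb0r0b1 ⊢; linarith)
  · refine orn fun kb0r0b1 => orn fun kb0r0r1 => orn fun kb0b1r1 => orp nb0b1b2 fun kb0b1b2 => orp nr0b1r1 fun kr0b1r1 => orp nr0b1b2 fun kr0b1b2 => orp nb1r1b2 fun kb1r1b2 => orn fun kb1r1r2 => orp nb1b2r2 fun kb1b2r2 => orp nr1b2r2 fun kr1b2r2 => ?_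
    have hv := B102 b1 r1 (Or.inl ⟨rfl, rfl⟩) (mul_neg_of_pos_of_neg kb0b1r1 kr0b1r1)
      (mul_pos kb0r0b1 (by linarith)) (mul_neg_of_neg_of_pos kb1r1b2 kb1r1r2) (mul_pos_of_neg_of_neg kb1b2r2 kr1b2r2)
    exact hull_contra (-1) b2 b0 hv (Or.inr (by unfold dt at kb0b1b2 ⊢; linarith))
      (Or.inr (by unfold dt at kr0b1b2 ⊢; linarith))
      (Or.inl rfl)
      (Or.inr (by unfold dt at kb1b2r2 ⊢; linarith))
      (by unfold dt at kb0b1b2 ⊢; linarith)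
  · refine orp nb0r0b1 fun kb0r0b1 => orp nb0r0r1 fun kb0r0r1 => orn fun kb0b1r1 => orp nr0b1r1 fun kr0b1r1 => orp nr0r1b2 fun kr0r1b2 => orp nr0r1r2 fun kr0r1r2 => orp nb1r1b2 fun kb1r1b2 => orn fun kb1r1r2 => orn fun kb1b2r2 => orn fun kr1b2r2 => ?_
    have hv := B102 r1 b1 (Or.inr ⟨rfl, rfl⟩) (mul_neg_of_pos_of_neg kb0b1r1 kr0b1r1)
      (mul_pos_of_neg_of_neg kb0r0r1 (by linarith)) (mul_neg_of_neg_of_pos kb1r1b2 kb1r1r2) (mul_pos kb1b2r2 kr1b2r2)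
    exact hull_contra (1) r0 b0 hv (Or.inr (by unfold dt at kb0r0r1 ⊢; linarith))
      (Or.inl rfl)
      (Or.inr (by unfold dt at kr0r1b2 ⊢; linarith))
      (Or.inr (by unfold dt at kr0r1r2 ⊢; linarith))
      (by unfold dt at kb0r0r1 ⊢; linarith)
  · refine orp nb0r0b1 fun kb0r0b1 => orp nb0r0r1 fun kb0r0r1 => orn fun kb0b1r1 => orn fun kb0r1b2 => orp nr0b1r1 fun kr0b1r1 => orn fun kr0r1b2 => orp nb1r1b2 fun kb1r1b2 => orn fun kb1r1r2 => orn fun kb1b2r2 => orn fun kr1b2r2 => ?_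
    have hv := B102 r1 b1 (Or.inr ⟨rfl, rfl⟩) (mul_neg_of_pos_of_neg kb0b1r1 kr0b1r1)
      (mul_pos_of_neg_of_neg kb0r0r1 (by linarith)) (mul_neg_of_neg_of_pos kb1r1b2 kb1r1r2) (mul_pos kb1b2r2 kr1b2r2)
    exact hull_contra (1) b2 b0 hv (Or.inr (by unfold dt at kb0r1b2 ⊢; linarith))
      (Or.inr (by unfold dt at kr0r1b2 ⊢; linarith))
      (Or.inl rfl)
      (Or.inr (by unfold dt at kr1b2r2 ⊢; linarith))
      (by unfold dt at kb0r1b2 ⊢; linarith)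
  · refine orp nb0r0b1 fun kb0r0b1 => orp nb0r0r1 fun kb0r0r1 => orn fun kb0b1r1 => orn fun kb0b1r2 => orp nr0b1r1 fun kr0b1r1 => orn fun kr0b1r2 => orp nb1r1b2 fun kb1r1b2 => orn fun kb1r1r2 => orp nb1b2r2 fun kb1b2r2 => orp nr1b2r2 fun kr1b2r2 => ?_
    have hv := B120 b1 r1 (Or.inl ⟨rfl, rfl⟩) (mul_neg_of_neg_of_pos kb1r1b2 kb1r1r2)
      (mul_pos_of_neg_of_neg kb1b2r2 (by linarith)) (mul_neg_of_pos_of_neg kb0b1r1 kr0b1r1) (mul_pos_of_neg_of_neg kb0r0b1 kb0r0r1)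
    exact hull_contra (1) r2 b2 hv (Or.inr (by unfold dt at kb1b2r2 ⊢; linarith))
      (Or.inl rfl)
      (Or.inr (by unfold dt at kb0b1r2 ⊢; linarith))
      (Or.inr (by unfold dt at kr0b1r2 ⊢; linarith))
      (by unfold dt at kb1b2r2 ⊢; linarith)
  · refine orp nb0r0b1 fun kb0r0b1 => orp nb0r0r1 fun kb0r0r1 => orp nb0r0b2 fun kb0r0b2 => orn fun kb0r0r2 => orn fun kb0b1r1 => orn fun kb0b1b2 => orn fun kb0r1b2 => orp nb0b2r2 fun kb0b2r2 => orp nr0b1r1 fun kr0b1r1 => orp nr0b2r2 fun kr0b2r2 => ?_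
    have hv := C102 b0 r0 (Or.inl ⟨rfl, rfl⟩) (mul_neg_of_neg_of_pos kb0r0b2 kb0r0r2)
      (mul_pos_of_neg_of_neg kb0b2r2 (by linarith)) (mul_neg_of_pos_of_neg kb0b1r1 kr0b1r1) (mul_pos_of_neg_of_neg kb0r0b1 kb0r0r1)
    exact hull_contra (-1) b2 b1 hv (Or.inr (by unfold dt at kb0b1b2 ⊢; linarith))
      (Or.inr (by unfold dt at kb0r1b2 ⊢; linarith))
      (Or.inl rfl)
      (Or.inr (by unfold dt at kb0b2r2 ⊢; linarith))
      (by unfold dt at kb0b1b2 ⊢; linarith)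
  · refine orp nb0r0b1 fun kb0r0b1 => orp nb0r0r1 fun kb0r0r1 => orp nb0r0b2 fun kb0r0b2 => orn fun kb0r0r2 => orn fun kb0b1r1 => orp nb0b1r2 fun kb0b1r2 => orp nb0r1r2 fun kb0r1r2 => orp nb0b2r2 fun kb0b2r2 => orp nr0b1r1 fun kr0b1r1 => orp nr0b2r2 fun kr0b2r2 => ?_
    have hv := C102 b0 r0 (Or.inl ⟨rfl, rfl⟩) (mul_neg_of_neg_of_pos kb0r0b2 kb0r0r2)
      (mul_pos_of_neg_of_neg kb0b2r2 (by linarith)) (mul_neg_of_pos_of_neg kb0b1r1 kr0b1r1) (mul_pos_of_neg_of_neg kb0r0b1 kb0r0r1)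
    exact hull_contra (1) r2 b1 hv (Or.inr (by unfold dt at kb0b1r2 ⊢; linarith))
      (Or.inr (by unfold dt at kb0r1r2 ⊢; linarith))
      (Or.inr (by unfold dt at kb0b2r2 ⊢; linarith))
      (Or.inl rfl)
      (by unfold dt at kb0b1r2 ⊢; linarith)
  · refine orp nb0r0b1 fun kb0r0b1 => orp nb0r0r1 fun kb0r0r1 => orp nb0r0b2 fun kb0r0b2 => orn fun kb0r0r2 => orn fun kb0b1r1 => orp nb0r1b2 fun kb0r1b2 => orp nb0r1r2 fun kb0r1r2 => orp nb0b2r2 fun kb0b2r2 => orp nr0b1r1 fun kr0b1r1 => orp nr0b2r2 fun kr0b2r2 => ?_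
    have hv := C102 b0 r0 (Or.inl ⟨rfl, rfl⟩) (mul_neg_of_neg_of_pos kb0r0b2 kb0r0r2)
      (mul_pos_of_neg_of_neg kb0b2r2 (by linarith)) (mul_neg_of_pos_of_neg kb0b1r1 kr0b1r1) (mul_pos_of_neg_of_neg kb0r0b1 kb0r0r1)
    exact hull_contra (-1) r1 b1 hv (Or.inr (by unfold dt at kb0b1r1 ⊢; linarith))
      (Or.inl rfl)
      (Or.inr (by unfold dt at kb0r1b2 ⊢; linarith))
      (Or.inr (by unfold dt at kb0r1r2 ⊢; linarith))
      (by unfold dt at kb0b1r1 ⊢; linarith)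
  · refine orn fun kb0r0b1 => orn fun kb0r0r1 => orp nb0r0b2 fun kb0r0b2 => orn fun kb0r0r2 => orn fun kb0b1r1 => orn fun kb0b1b2 => orn fun kb0r1b2 => orp nb0b2r2 fun kb0b2r2 => orp nr0b1r1 fun kr0b1r1 => orp nr0b2r2 fun kr0b2r2 => ?_
    have hv := C102 b0 r0 (Or.inl ⟨rfl, rfl⟩) (mul_neg_of_neg_of_pos kb0r0b2 kb0r0r2)
      (mul_pos_of_neg_of_neg kb0b2r2 (by linarith)) (mul_neg_of_pos_of_neg kb0b1r1 kr0b1r1) (mul_pos kb0r0b1 kb0r0r1)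
    exact hull_contra (-1) b2 b1 hv (Or.inr (by unfold dt at kb0b1b2 ⊢; linarith))
      (Or.inr (by unfold dt at kb0r1b2 ⊢; linarith))
      (Or.inl rfl)
      (Or.inr (by unfold dt at kb0b2r2 ⊢; linarith))
      (by unfold dt at kb0b1b2 ⊢; linarith)
  · refine orn fun kb0r0b1 => orn fun kb0r0r1 => orp nb0r0b2 fun kb0r0b2 => orn fun kb0r0r2 => orn fun kb0b1r1 => orn fun kb0b1b2 => orn fun kb0b1r2 => orp nb0b2r2 fun kb0b2r2 => orp nr0b1r1 fun kr0b1r1 => orp nr0b2r2 fun kr0b2r2 => ?_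
    have hv := C102 b0 r0 (Or.inl ⟨rfl, rfl⟩) (mul_neg_of_neg_of_pos kb0r0b2 kb0r0r2)
      (mul_pos_of_neg_of_neg kb0b2r2 (by linarith)) (mul_neg_of_pos_of_neg kb0b1r1 kr0b1r1) (mul_pos kb0r0b1 kb0r0r1)
    exact hull_contra (1) b1 r1 hv (Or.inl rfl)
      (Or.inr (by unfold dt at kb0b1r1 ⊢; linarith))
      (Or.inr (by unfold dt at kb0b1b2 ⊢; linarith))
      (Or.inr (by unfold dt at kb0b1r2 ⊢; linarith))
      (by unfold dt at kb0b1r1 ⊢; linarith)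
  · refine orn fun kb0r0b1 => orn fun kb0r0r1 => orp nb0r0b2 fun kb0r0b2 => orn fun kb0r0r2 => orn fun kb0b1r1 => orp nb0r1b2 fun kb0r1b2 => orp nb0r1r2 fun kb0r1r2 => orp nb0b2r2 fun kb0b2r2 => orp nr0b1r1 fun kr0b1r1 => orp nr0b2r2 fun kr0b2r2 => ?_
    have hv := C102 b0 r0 (Or.inl ⟨rfl, rfl⟩) (mul_neg_of_neg_of_pos kb0r0b2 kb0r0r2)
      (mul_pos_of_neg_of_neg kb0b2r2 (by linarith)) (mul_neg_of_pos_of_neg kb0b1r1 kr0b1r1) (mul_pos kb0r0b1 kb0r0r1)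
    exact hull_contra (-1) r1 b1 hv (Or.inr (by unfold dt at kb0b1r1 ⊢; linarith))
      (Or.inl rfl)
      (Or.inr (by unfold dt at kb0r1b2 ⊢; linarith))
      (Or.inr (by unfold dt at kb0r1r2 ⊢; linarith))
      (by unfold dt at kb0b1r1 ⊢; linarith)
  · refine orp nb0r0b1 fun kb0r0b1 => orp nb0r0r1 fun kb0r0r1 => orp nb0r0b2 fun kb0r0b2 => orn fun kb0r0r2 => orn fun kb0b1r1 => orn fun kb0b2r2 => orp nr0b1r1 fun kr0b1r1 => orp nr0b1b2 fun kr0b1b2 => orp nr0r1b2 fun kr0r1b2 => orn fun kr0b2r2 => ?_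
    have hv := C102 r0 b0 (Or.inr ⟨rfl, rfl⟩) (mul_neg_of_neg_of_pos kb0r0b2 kb0r0r2)
      (mul_pos kr0b2r2 (by linarith)) (mul_neg_of_pos_of_neg kb0b1r1 kr0b1r1) (mul_pos_of_neg_of_neg kb0r0b1 kb0r0r1)
    exact hull_contra (1) b2 b1 hv (Or.inr (by unfold dt at kr0b1b2 ⊢; linarith))
      (Or.inr (by unfold dt at kr0r1b2 ⊢; linarith))
      (Or.inl rfl)
      (Or.inr (by unfold dt at kr0b2r2 ⊢; linarith))
      (by unfold dt at kr0b1b2 ⊢; linarith)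
  · refine orp nb0r0b1 fun kb0r0b1 => orp nb0r0r1 fun kb0r0r1 => orp nb0r0b2 fun kb0r0b2 => orn fun kb0r0r2 => orn fun kb0b1r1 => orn fun kb0b2r2 => orp nr0b1r1 fun kr0b1r1 => orn fun kr0r1b2 => orn fun kr0r1r2 => orn fun kr0b2r2 => ?_
    have hv := C102 r0 b0 (Or.inr ⟨rfl, rfl⟩) (mul_neg_of_neg_of_pos kb0r0b2 kb0r0r2)
      (mul_pos kr0b2r2 (by linarith)) (mul_neg_of_pos_of_neg kb0b1r1 kr0b1r1) (mul_pos_of_neg_of_neg kb0r0b1 kb0r0r1)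
    exact hull_contra (1) r1 b1 hv (Or.inr (by unfold dt at kr0b1r1 ⊢; linarith))
      (Or.inl rfl)
      (Or.inr (by unfold dt at kr0r1b2 ⊢; linarith))
      (Or.inr (by unfold dt at kr0r1r2 ⊢; linarith))
      (by unfold dt at kr0b1r1 ⊢; linarith)
  · refine orn fun kb0r0b1 => orn fun kb0r0r1 => orp nb0r0b2 fun kb0r0b2 => orn fun kb0r0r2 => orn fun kb0b1r1 => orn fun kb0b2r2 => orp nr0b1r1 fun kr0b1r1 => orp nr0b1b2 fun kr0b1b2 => orp nr0r1b2 fun kr0r1b2 => orn fun kr0b2r2 => ?_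
    have hv := C102 r0 b0 (Or.inr ⟨rfl, rfl⟩) (mul_neg_of_neg_of_pos kb0r0b2 kb0r0r2)
      (mul_pos kr0b2r2 (by linarith)) (mul_neg_of_pos_of_neg kb0b1r1 kr0b1r1) (mul_pos kb0r0b1 kb0r0r1)
    exact hull_contra (1) b2 b1 hv (Or.inr (by unfold dt at kr0b1b2 ⊢; linarith))
      (Or.inr (by unfold dt at kr0r1b2 ⊢; linarith))
      (Or.inl rfl)
      (Or.inr (by unfold dt at kr0b2r2 ⊢; linarith))
      (by unfold dt at kr0b1b2 ⊢; linarith)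
  · refine orn fun kb0r0b1 => orn fun kb0r0r1 => orp nb0r0b2 fun kb0r0b2 => orn fun kb0r0r2 => orn fun kb0b1r1 => orn fun kb0b2r2 => orp nr0b1r1 fun kr0b1r1 => orn fun kr0r1b2 => orn fun kr0r1r2 => orn fun kr0b2r2 => ?_
    have hv := C102 r0 b0 (Or.inr ⟨rfl, rfl⟩) (mul_neg_of_neg_of_pos kb0r0b2 kb0r0r2)
      (mul_pos kr0b2r2 (by linarith)) (mul_neg_of_pos_of_neg kb0b1r1 kr0b1r1) (mul_pos kb0r0b1 kb0r0r1)
    exact hull_contra (1) r1 b1 hv (Or.inr (by unfold dt at kr0b1r1 ⊢; linarith))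
      (Or.inl rfl)
      (Or.inr (by unfold dt at kr0r1b2 ⊢; linarith))
      (Or.inr (by unfold dt at kr0r1r2 ⊢; linarith))
      (by unfold dt at kr0b1r1 ⊢; linarith)
  · refine orn fun kb0r0b2 => orn fun kb0r0r2 => orn fun kb0b1b2 => orn fun kb0r1b2 => orn fun kb0b2r2 => orp nr0b2r2 fun kr0b2r2 => orp nb1r1b2 fun kb1r1b2 => orn fun kb1r1r2 => orp nb1b2r2 fun kb1b2r2 => orp nr1b2r2 fun kr1b2r2 => ?_
    have hv := C120 b2 r2 (Or.inl ⟨rfl, rfl⟩) (mul_neg_of_pos_of_neg kb0b2r2 kr0b2r2)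
      (mul_pos kb0r0b2 (by linarith)) (mul_neg_of_neg_of_pos kb1r1b2 kb1r1r2) (mul_pos_of_neg_of_neg kb1b2r2 kr1b2r2)
    exact hull_contra (1) b0 b1 hv (Or.inr (by unfold dt at kb0b1b2 ⊢; linarith))
      (Or.inr (by unfold dt at kb0r1b2 ⊢; linarith))
      (Or.inl rfl)
      (Or.inr (by unfold dt at kb0r0b2 ⊢; linarith))
      (by unfold dt at kb0b1b2 ⊢; linarith)
  · refine orn fun kb0r0b2 => orn fun kb0r0r2 => orn fun kb0b1b2 => orn fun kb0b2r2 => orn fun kr0b1b2 => orp nr0b2r2 fun kr0b2r2 => orp nb1r1b2 fun kb1r1b2 => orn fun kb1r1r2 => orp nb1b2r2 fun kb1b2r2 => orp nr1b2r2 fun kr1b2r2 => ?_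
    have hv := C120 b2 r2 (Or.inl ⟨rfl, rfl⟩) (mul_neg_of_pos_of_neg kb0b2r2 kr0b2r2)
      (mul_pos kb0r0b2 (by linarith)) (mul_neg_of_neg_of_pos kb1r1b2 kb1r1r2) (mul_pos_of_neg_of_neg kb1b2r2 kr1b2r2)
    exact hull_contra (-1) b1 r1 hv (Or.inl rfl)
      (Or.inr (by unfold dt at kb1r1b2 ⊢; linarith))
      (Or.inr (by unfold dt at kb0b1b2 ⊢; linarith))
      (Or.inr (by unfold dt at kr0b1b2 ⊢; linarith))
      (by unfold dt at kb1r1b2 ⊢; linarith)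
  · refine orn fun kb0r0b2 => orn fun kb0r0r2 => orp nb0r1b2 fun kb0r1b2 => orn fun kb0b2r2 => orp nr0r1b2 fun kr0r1b2 => orp nr0b2r2 fun kr0b2r2 => orp nb1r1b2 fun kb1r1b2 => orn fun kb1r1r2 => orp nb1b2r2 fun kb1b2r2 => orp nr1b2r2 fun kr1b2r2 => ?_
    have hv := C120 b2 r2 (Or.inl ⟨rfl, rfl⟩) (mul_neg_of_pos_of_neg kb0b2r2 kr0b2r2)
      (mul_pos kb0r0b2 (by linarith)) (mul_neg_of_neg_of_pos kb1r1b2 kb1r1r2) (mul_pos_of_neg_of_neg kb1b2r2 kr1b2r2)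
    exact hull_contra (1) r1 b1 hv (Or.inr (by unfold dt at kb1r1b2 ⊢; linarith))
      (Or.inl rfl)
      (Or.inr (by unfold dt at kb0r1b2 ⊢; linarith))
      (Or.inr (by unfold dt at kr0r1b2 ⊢; linarith))
      (by unfold dt at kb1r1b2 ⊢; linarith)
  · refine orn fun kb0r0b2 => orn fun kb0r0r2 => orn fun kb0b2r2 => orp nr0b1b2 fun kr0b1b2 => orp nr0r1b2 fun kr0r1b2 => orp nr0b2r2 fun kr0b2r2 => orp nb1r1b2 fun kb1r1b2 => orn fun kb1r1r2 => orn fun kb1b2r2 => orn fun kr1b2r2 => ?_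
    have hv := C120 b2 r2 (Or.inl ⟨rfl, rfl⟩) (mul_neg_of_pos_of_neg kb0b2r2 kr0b2r2)
      (mul_pos kb0r0b2 (by linarith)) (mul_neg_of_neg_of_pos kb1r1b2 kb1r1r2) (mul_pos kb1b2r2 kr1b2r2)
    exact hull_contra (-1) r0 b1 hv (Or.inr (by unfold dt at kr0b1b2 ⊢; linarith))
      (Or.inr (by unfold dt at kr0r1b2 ⊢; linarith))
      (Or.inr (by unfold dt at kb0r0b2 ⊢; linarith))
      (Or.inl rfl)
      (by unfold dt at kr0b1b2 ⊢; linarith)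
  · refine orn fun kb0r0b2 => orn fun kb0r0r2 => orn fun kb0b1b2 => orn fun kb0b2r2 => orn fun kr0b1b2 => orp nr0b2r2 fun kr0b2r2 => orp nb1r1b2 fun kb1r1b2 => orn fun kb1r1r2 => orn fun kb1b2r2 => orn fun kr1b2r2 => ?_
    have hv := C120 b2 r2 (Or.inl ⟨rfl, rfl⟩) (mul_neg_of_pos_of_neg kb0b2r2 kr0b2r2)
      (mul_pos kb0r0b2 (by linarith)) (mul_neg_of_neg_of_pos kb1r1b2 kb1r1r2) (mul_pos kb1b2r2 kr1b2r2)
    exact hull_contra (-1) b1 r1 hv (Or.inl rfl)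
      (Or.inr (by unfold dt at kb1r1b2 ⊢; linarith))
      (Or.inr (by unfold dt at kb0b1b2 ⊢; linarith))
      (Or.inr (by unfold dt at kr0b1b2 ⊢; linarith))
      (by unfold dt at kb1r1b2 ⊢; linarith)
  · refine orp nb0r0b2 fun kb0r0b2 => orp nb0r0r2 fun kb0r0r2 => orp nb0b1r2 fun kb0b1r2 => orp nb0r1r2 fun kb0r1r2 => orn fun kb0b2r2 => orp nr0b2r2 fun kr0b2r2 => orp nb1r1b2 fun kb1r1b2 => orn fun kb1r1r2 => orp nb1b2r2 fun kb1b2r2 => orp nr1b2r2 fun kr1b2r2 => ?_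
    have hv := C120 r2 b2 (Or.inr ⟨rfl, rfl⟩) (mul_neg_of_pos_of_neg kb0b2r2 kr0b2r2)
      (mul_pos_of_neg_of_neg kb0r0r2 (by linarith)) (mul_neg_of_neg_of_pos kb1r1b2 kb1r1r2) (mul_pos_of_neg_of_neg kb1b2r2 kr1b2r2)
    exact hull_contra (-1) b0 b1 hv (Or.inr (by unfold dt at kb0b1r2 ⊢; linarith))
      (Or.inr (by unfold dt at kb0r1r2 ⊢; linarith))
      (Or.inl rfl)
      (Or.inr (by unfold dt at kb0r0r2 ⊢; linarith))
      (by unfold dt at kb0b1r2 ⊢; linarith)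
  · refine orp nb0r0b2 fun kb0r0b2 => orp nb0r0r2 fun kb0r0r2 => orn fun kb0r1r2 => orn fun kb0b2r2 => orn fun kr0r1r2 => orp nr0b2r2 fun kr0b2r2 => orp nb1r1b2 fun kb1r1b2 => orn fun kb1r1r2 => orp nb1b2r2 fun kb1b2r2 => orp nr1b2r2 fun kr1b2r2 => ?_
    have hv := C120 r2 b2 (Or.inr ⟨rfl, rfl⟩) (mul_neg_of_pos_of_neg kb0b2r2 kr0b2r2)
      (mul_pos_of_neg_of_neg kb0r0r2 (by linarith)) (mul_neg_of_neg_of_pos kb1r1b2 kb1r1r2) (mul_pos_of_neg_of_neg kb1b2r2 kr1b2r2)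
    exact hull_contra (-1) r1 b1 hv (Or.inr (by unfold dt at kb1r1r2 ⊢; linarith))
      (Or.inl rfl)
      (Or.inr (by unfold dt at kb0r1r2 ⊢; linarith))
      (Or.inr (by unfold dt at kr0r1r2 ⊢; linarith))
      (by unfold dt at kb1r1r2 ⊢; linarith)
  · refine orp nb0r0b2 fun kb0r0b2 => orp nb0r0r2 fun kb0r0r2 => orp nb0b1r2 fun kb0b1r2 => orp nb0r1r2 fun kb0r1r2 => orn fun kb0b2r2 => orp nr0b2r2 fun kr0b2r2 => orp nb1r1b2 fun kb1r1b2 => orn fun kb1r1r2 => orn fun kb1b2r2 => orn fun kr1b2r2 => ?_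
    have hv := C120 r2 b2 (Or.inr ⟨rfl, rfl⟩) (mul_neg_of_pos_of_neg kb0b2r2 kr0b2r2)
      (mul_pos_of_neg_of_neg kb0r0r2 (by linarith)) (mul_neg_of_neg_of_pos kb1r1b2 kb1r1r2) (mul_pos kb1b2r2 kr1b2r2)
    exact hull_contra (-1) b0 b1 hv (Or.inr (by unfold dt at kb0b1r2 ⊢; linarith))
      (Or.inr (by unfold dt at kb0r1r2 ⊢; linarith))
      (Or.inl rfl)
      (Or.inr (by unfold dt at kb0r0r2 ⊢; linarith))
      (by unfold dt at kb0b1r2 ⊢; linarith)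
  · refine orp nb0r0b2 fun kb0r0b2 => orp nb0r0r2 fun kb0r0r2 => orn fun kb0r1r2 => orn fun kb0b2r2 => orn fun kr0r1r2 => orp nr0b2r2 fun kr0b2r2 => orp nb1r1b2 fun kb1r1b2 => orn fun kb1r1r2 => orn fun kb1b2r2 => orn fun kr1b2r2 => ?_
    have hv := C120 r2 b2 (Or.inr ⟨rfl, rfl⟩) (mul_neg_of_pos_of_neg kb0b2r2 kr0b2r2)
      (mul_pos_of_neg_of_neg kb0r0r2 (by linarith)) (mul_neg_of_neg_of_pos kb1r1b2 kb1r1r2) (mul_pos kb1b2r2 kr1b2r2)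
    exact hull_contra (-1) r1 b1 hv (Or.inr (by unfold dt at kb1r1r2 ⊢; linarith))
      (Or.inl rfl)
      (Or.inr (by unfold dt at kb0r1r2 ⊢; linarith))
      (Or.inr (by unfold dt at kr0r1r2 ⊢; linarith))
      (by unfold dt at kb1r1r2 ⊢; linarith)
  · refine orp nb0r0b1 fun kb0r0b1 => orn fun kb0r0r1 => orn fun kb0r0b2 => orn fun kb0r0r2 => orp nb0b1r1 fun kb0b1r1 => orn fun kb0r1b2 => orn fun kb0r1r2 => orn fun kb0b2r2 => orp nr0b1r1 fun kr0b1r1 => orp nr0b2r2 fun kr0b2r2 => ?_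
    have hv := C201 b0 r0 (Or.inl ⟨rfl, rfl⟩) (mul_neg_of_neg_of_pos kb0r0b1 kb0r0r1)
      (mul_pos_of_neg_of_neg kb0b1r1 (by linarith)) (mul_neg_of_pos_of_neg kb0b2r2 kr0b2r2) (mul_pos kb0r0b2 kb0r0r2)
    exact hull_contra (1) r1 b2 hv (Or.inr (by unfold dt at kb0r1b2 ⊢; linarith))
      (Or.inr (by unfold dt at kb0r1r2 ⊢; linarith))
      (Or.inr (by unfold dt at kb0b1r1 ⊢; linarith))
      (Or.inl rfl)
      (by unfold dt at kb0r1b2 ⊢; linarith)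
  · refine orn fun kb0r0b1 => orn fun kb0r0r1 => orn fun kb0b1r1 => orp nb0b1b2 fun kb0b1b2 => orp nb0b1r2 fun kb0b1r2 => orp nr0b1r1 fun kr0b1r1 => orn fun kb1r1b2 => orn fun kb1r1r2 => orn fun kb1b2r2 => orp nr1b2r2 fun kr1b2r2 => ?_
    have hv := C210 b1 r1 (Or.inl ⟨rfl, rfl⟩) (mul_neg_of_pos_of_neg kb0b1r1 kr0b1r1)
      (mul_pos kb0r0b1 (by linarith)) (mul_neg_of_pos_of_neg kb1b2r2 kr1b2r2) (mul_pos kb1r1b2 kb1r1r2)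
    exact hull_contra (1) b0 b2 hv (Or.inr (by unfold dt at kb0b1b2 ⊢; linarith))
      (Or.inr (by unfold dt at kb0b1r2 ⊢; linarith))
      (Or.inl rfl)
      (Or.inr (by unfold dt at kb0r0b1 ⊢; linarith))
      (by unfold dt at kb0b1b2 ⊢; linarith)
  · refine orp nb0r0b1 fun kb0r0b1 => orn fun kb0r0r1 => orp nb0r0b2 fun kb0r0b2 => orn fun kb0r0r2 => ?_
    have hx : dt r0 b0 r1 ≠ 0 := by
      unfold dt at kb0r0r1 ⊢; intro h; linarith
    exact hno (perturb3 (-1) r0 b0 r1 r0 r1 r2 b0 b1 b2 hx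
      (Or.inl rfl)
      (Or.inr (by unfold dt at kb0r0r1 ⊢; linarith))
      (Or.inr (by unfold dt at kb0r0r2 ⊢; linarith))
      (Or.inl rfl)
      (Or.inr (by unfold dt at kb0r0b1 ⊢; linarith))
      (Or.inr (by unfold dt at kb0r0b2 ⊢; linarith)))
  · refine orn fun kb0r0b1 => orp nr0b1r1 fun kr0b1r1 => orn fun kr0b1b2 => orp nr0b1r2 fun kr0b1r2 => ?_
    have hx : dt r0 b1 r1 ≠ 0 := by
      unfold dt at kr0b1r1 ⊢; intro h; linarith
    exact hno (perturb3 (-1) r0 b1 r1 r0 r1 r2 b0 b1 b2 hx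
      (Or.inl rfl)
      (Or.inr (by unfold dt at kr0b1r1 ⊢; linarith))
      (Or.inr (by unfold dt at kr0b1r2 ⊢; linarith))
      (Or.inr (by unfold dt at kb0r0b1 ⊢; linarith))
      (Or.inl rfl)
      (Or.inr (by unfold dt at kr0b1b2 ⊢; linarith)))
  · refine orn fun kb0r0b2 => orp nr0b1b2 fun kr0b1b2 => orn fun kr0r1b2 => orp nr0b2r2 fun kr0b2r2 => ?_
    have hx : dt r0 b2 r1 ≠ 0 := by
      unfold dt at kr0r1b2 ⊢; intro h; linarith
    exact hno (perturb3 (-1) r0 b2 r1 r0 r1 r2 b0 b1 b2 hx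
      (Or.inl rfl)
      (Or.inr (by unfold dt at kr0r1b2 ⊢; linarith))
      (Or.inr (by unfold dt at kr0b2r2 ⊢; linarith))
      (Or.inr (by unfold dt at kb0r0b2 ⊢; linarith))
      (Or.inr (by unfold dt at kr0b1b2 ⊢; linarith))
      (Or.inl rfl))
  · refine orp nb0r0b2 fun kb0r0b2 => orn fun kr0b1b2 => orp nr0r1b2 fun kr0r1b2 => orn fun kr0b2r2 => ?_
    have hx : dt r0 b2 r1 ≠ 0 := by
      unfold dt at kr0r1b2 ⊢; intro h; linarith
    exact hno (perturb3 (1) r0 b2 r1 r0 r1 r2 b0 b1 b2 hx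
      (Or.inl rfl)
      (Or.inr (by unfold dt at kr0r1b2 ⊢; linarith))
      (Or.inr (by unfold dt at kr0b2r2 ⊢; linarith))
      (Or.inr (by unfold dt at kb0r0b2 ⊢; linarith))
      (Or.inr (by unfold dt at kr0b1b2 ⊢; linarith))
      (Or.inl rfl))
  · refine orp nb0r0r1 fun kb0r0r1 => orn fun kb0b1r1 => orp nb0r1b2 fun kb0r1b2 => orn fun kb0r1r2 => ?_
    have hx : dt r1 b0 r0 ≠ 0 := by
      unfold dt at kb0r0r1 ⊢; intro h; linarith
    exact hno (perturb3 (-1) r1 b0 r0 r0 r1 r2 b0 b1 b2 hx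
      (Or.inr (by unfold dt at kb0r0r1 ⊢; linarith))
      (Or.inl rfl)
      (Or.inr (by unfold dt at kb0r1r2 ⊢; linarith))
      (Or.inl rfl)
      (Or.inr (by unfold dt at kb0b1r1 ⊢; linarith))
      (Or.inr (by unfold dt at kb0r1b2 ⊢; linarith)))
  · refine orn fun kb0r0r1 => orp nb0b1r1 fun kb0b1r1 => orn fun kb0r1b2 => orp nb0r1r2 fun kb0r1r2 => ?_
    have hx : dt r1 b0 r0 ≠ 0 := by
      unfold dt at kb0r0r1 ⊢; intro h; linarith
    exact hno (perturb3 (1) r1 b0 r0 r0 r1 r2 b0 b1 b2 hx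
      (Or.inr (by unfold dt at kb0r0r1 ⊢; linarith))
      (Or.inl rfl)
      (Or.inr (by unfold dt at kb0r1r2 ⊢; linarith))
      (Or.inl rfl)
      (Or.inr (by unfold dt at kb0b1r1 ⊢; linarith))
      (Or.inr (by unfold dt at kb0r1b2 ⊢; linarith)))
  · refine orp nb0r1b2 fun kb0r1b2 => orn fun kr0r1b2 => orp nb1r1b2 fun kb1r1b2 => orn fun kr1b2r2 => ?_
    have hx : dt r1 b2 r0 ≠ 0 := by
      unfold dt at kr0r1b2 ⊢; intro h; linarith
    exact hno (perturb3 (1) r1 b2 r0 r0 r1 r2 b0 b1 b2 hx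
      (Or.inr (by unfold dt at kr0r1b2 ⊢; linarith))
      (Or.inl rfl)
      (Or.inr (by unfold dt at kr1b2r2 ⊢; linarith))
      (Or.inr (by unfold dt at kb0r1b2 ⊢; linarith))
      (Or.inr (by unfold dt at kb1r1b2 ⊢; linarith))
      (Or.inl rfl))
  · refine orp nb0r0r2 fun kb0r0r2 => orn fun kb0b1r2 => orp nb0r1r2 fun kb0r1r2 => orn fun kb0b2r2 => ?_
    have hx : dt r2 b0 r0 ≠ 0 := by
      unfold dt at kb0r0r2 ⊢; intro h; linarith
    exact hno (perturb3 (-1) r2 b0 r0 r0 r1 r2 b0 b1 b2 hx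
      (Or.inr (by unfold dt at kb0r0r2 ⊢; linarith))
      (Or.inr (by unfold dt at kb0r1r2 ⊢; linarith))
      (Or.inl rfl)
      (Or.inl rfl)
      (Or.inr (by unfold dt at kb0b1r2 ⊢; linarith))
      (Or.inr (by unfold dt at kb0b2r2 ⊢; linarith)))
  · refine orn fun kb0r0r2 => orp nb0b1r2 fun kb0b1r2 => orn fun kb0r1r2 => orp nb0b2r2 fun kb0b2r2 => ?_
    have hx : dt r2 b0 r0 ≠ 0 := by
      unfold dt at kb0r0r2 ⊢; intro h; linarith
    exact hno (perturb3 (1) r2 b0 r0 r0 r1 r2 b0 b1 b2 hx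
      (Or.inr (by unfold dt at kb0r0r2 ⊢; linarith))
      (Or.inr (by unfold dt at kb0r1r2 ⊢; linarith))
      (Or.inl rfl)
      (Or.inl rfl)
      (Or.inr (by unfold dt at kb0b1r2 ⊢; linarith))
      (Or.inr (by unfold dt at kb0b2r2 ⊢; linarith)))
  · refine orn fun kb0b1r2 => orp nr0b1r2 fun kr0b1r2 => orn fun kb1r1r2 => orp nb1b2r2 fun kb1b2r2 => ?_
    have hx : dt r2 b1 r0 ≠ 0 := by
      unfold dt at kr0b1r2 ⊢; intro h; linarith
    exact hno (perturb3 (1) r2 b1 r0 r0 r1 r2 b0 b1 b2 hx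
      (Or.inr (by unfold dt at kr0b1r2 ⊢; linarith))
      (Or.inr (by unfold dt at kb1r1r2 ⊢; linarith))
      (Or.inl rfl)
      (Or.inr (by unfold dt at kb0b1r2 ⊢; linarith))
      (Or.inl rfl)
      (Or.inr (by unfold dt at kb1b2r2 ⊢; linarith)))
  · refine orn fun kb0b2r2 => orp nr0b2r2 fun kr0b2r2 => orn fun kb1b2r2 => orp nr1b2r2 fun kr1b2r2 => ?_
    have hx : dt r2 b2 r0 ≠ 0 := by
      unfold dt at kr0b2r2 ⊢; intro h; linarith
    exact hno (perturb3 (1) r2 b2 r0 r0 r1 r2 b0 b1 b2 hx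
      (Or.inr (by unfold dt at kr0b2r2 ⊢; linarith))
      (Or.inr (by unfold dt at kr1b2r2 ⊢; linarith))
      (Or.inl rfl)
      (Or.inr (by unfold dt at kb0b2r2 ⊢; linarith))
      (Or.inr (by unfold dt at kb1b2r2 ⊢; linarith))
      (Or.inl rfl))
theorem sideVal_lin (a b : ℝ) (s t : ℝ × ℝ × ℝ) (p : ℝ × ℝ) :
    sideVal (a • s + b • t) p = a * sideVal s p + b * sideVal t p := by
  simp only [sideVal, Prod.fst_add, Prod.snd_add, Prod.smul_fst, Prod.smul_snd, smul_eq_mul]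
  ring

/-- The (open, convex) cone of oriented lines with the lower endpoint of `e` on the negative side
and the upper endpoint on the positive side. -/
def sepCone (e : (ℝ × ℝ) × (ℝ × ℝ)) : Set (ℝ × ℝ × ℝ) :=
  {s | sideVal s e.1 < 0 ∧ 0 < sideVal s e.2}

theorem mem_sepCone {e : (ℝ × ℝ) × (ℝ × ℝ)} {s : ℝ × ℝ × ℝ} :
    s ∈ sepCone e ↔ sideVal s e.1 < 0 ∧ 0 < sideVal s e.2 := Iff.rfl

theorem comb_pos {a b x y : ℝ} (ha : 0 ≤ a) (hb : 0 ≤ b) (hab : a + b = 1) (hx : 0 < x)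
    (hy : 0 < y) : 0 < a * x + b * y := by
  rcases eq_or_lt_of_le ha with h | h
  · have : b = 1 := by linarith
    rw [← h, this]; linarith
  · have := mul_pos h hx
    have := mul_nonneg hb hy.le
    linarith

theorem convex_sepCone (e : (ℝ × ℝ) × (ℝ × ℝ)) : Convex ℝ (sepCone e) := by
  intro s hs t ht a b ha hb hab
  rw [mem_sepCone] at hs ht ⊢
  rw [sideVal_lin, sideVal_lin]
  refine ⟨?_, comb_pos ha hb hab hs.2 ht.2⟩
  have := comb_pos ha hb hab (neg_pos.2 hs.1) (neg_pos.2 ht.1)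
  linarith

/-- A nonnegative combination, with a coefficient vanishing where positivity is unknown. -/
theorem sum_pos_aux (c x : Fin 4 → ℝ) (j k : Fin 4) (hc : ∀ i, 0 ≤ c i)
    (hx : ∀ i, i ≠ j → 0 < x i) (hj : c j = 0) (hk : 0 < c k) : 0 < ∑ i, c i * x i := by
  have hkj : k ≠ j := by
    rintro rfl; rw [hj] at hk; exact lt_irrefl _ hk
  apply Finset.sum_pos'
  · intro i _
    by_cases h : i = j
    · subst h; rw [hj]; simp
    · exact mul_nonneg (hc i) (hx i h).le
  · exact ⟨k, Finset.mem_univ _, mul_pos hk (hx k hkj)⟩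

theorem sideVal_sum (c : Fin 4 → ℝ) (s : Fin 4 → ℝ × ℝ × ℝ) (p : ℝ × ℝ) :
    sideVal (∑ i, c i • s i) p = ∑ i, c i * sideVal (s i) p := by
  simp only [Fin.sum_univ_four, sideVal, Prod.fst_add, Prod.snd_add, Prod.smul_fst,
    Prod.smul_snd, smul_eq_mul]
  ring

/-- Among three reals one lies between the other two. -/
theorem exists_middle (κ : Fin 4 → ℝ) :
    ∃ j a c : Fin 4, a ≠ j ∧ c ≠ j ∧ κ a ≤ κ j ∧ κ j ≤ κ c := by
  rcases le_total (κ 0) (κ 1) with h1 | h1 <;> rcases le_total (κ 1) (κ 2) with h2 | h2 <;>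
    rcases le_total (κ 0) (κ 2) with h3 | h3
  · exact ⟨1, 0, 2, by decide, by decide, h1, h2⟩
  · exact ⟨1, 0, 2, by decide, by decide, h1, h2⟩
  · exact ⟨2, 0, 1, by decide, by decide, h3, h2⟩
  · exact ⟨0, 2, 1, by decide, by decide, h3, h1⟩
  · exact ⟨0, 1, 2, by decide, by decide, h1, h3⟩
  · exact ⟨2, 1, 0, by decide, by decide, h2, h3⟩
  · exact ⟨1, 2, 0, by decide, by decide, h2, h1⟩
  · exact ⟨1, 2, 0, by decide, by decide, h2, h1⟩

/-- Positive dependence of the four separators is impossible. -/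
theorem no_pos_dep (e : Fin 4 → (ℝ × ℝ) × (ℝ × ℝ)) (hlow : ∀ i, (e i).1.2 < (e i).2.2)
    (s : Fin 4 → ℝ × ℝ × ℝ) (hs : ∀ i j, j ≠ i → s i ∈ sepCone (e j))
    (c : Fin 4 → ℝ) (hc : ∀ i, 0 ≤ c i) (k : Fin 4) (hk : 0 < c k)
    (h0 : ∑ i, c i • s i = 0) : False := by
  let κ : Fin 4 → ℝ := fun i => ((e i).2.1 - (e i).1.1) / ((e i).2.2 - (e i).1.2)
  have hpos : ∀ i j, j ≠ i → 0 < (s i).1 * κ j + (s i).2.1 := by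
    intro i j hij
    have h := hs i j hij
    rw [mem_sepCone] at h
    have hy : 0 < (e j).2.2 - (e j).1.2 := sub_pos.2 (hlow j)
    have h1 : 0 < (s i).1 * ((e j).2.1 - (e j).1.1) + (s i).2.1 * ((e j).2.2 - (e j).1.2) := by
      simp only [sideVal] at h
      linarith [h.1, h.2]
    have h2 : (s i).1 * κ j + (s i).2.1 =
        ((s i).1 * ((e j).2.1 - (e j).1.1) + (s i).2.1 * ((e j).2.2 - (e j).1.2)) /
          ((e j).2.2 - (e j).1.2) := by
      simp only [κ]; field_simp
    rw [h2]; exact div_pos h1 hy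
  obtain ⟨j, a, b, haj, hbj, h1, h2⟩ := exists_middle κ
  have hall : ∀ i, 0 < (s i).1 * κ j + (s i).2.1 := by
    intro i
    by_cases hij : j = i
    · subst hij
      have ha := hpos j a haj
      have hb := hpos j b hbj
      rcases le_total 0 (s j).1 with h | h
      · have := mul_le_mul_of_nonneg_left h1 h; linarith
      · have := mul_le_mul_of_nonpos_left h2 h; linarith
    · exact hpos i j hij
  have hsum : ∑ i, c i * ((s i).1 * κ j + (s i).2.1) = 0 := by
    have e1 := congrArg Prod.fst h0
    have e2 := congrArg (fun q => q.2.1) h0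
    simp only [Fin.sum_univ_four, Prod.fst_add, Prod.snd_add, Prod.smul_fst,
      Prod.smul_snd, smul_eq_mul, Prod.fst_zero, Prod.snd_zero] at e1 e2 ⊢
    linear_combination κ j * e1 + e2
  have : 0 < ∑ i, c i * ((s i).1 * κ j + (s i).2.1) :=
    Finset.sum_pos' (fun i _ => mul_nonneg (hc i) (hall i).le)
      ⟨k, Finset.mem_univ _, mul_pos hk (hall k)⟩
  linarith

/-- If any three of four upward edges can be separated, then all four can. -/
theorem four (e : Fin 4 → (ℝ × ℝ) × (ℝ × ℝ)) (hlow : ∀ i, (e i).1.2 < (e i).2.2)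
    (s : Fin 4 → ℝ × ℝ × ℝ) (hs : ∀ i j, j ≠ i → s i ∈ sepCone (e j)) :
    ∃ t, ∀ j, t ∈ sepCone (e j) := by
  have hdep : ¬ LinearIndependent ℝ s := by
    intro h
    have := h.fintype_card_le_finrank
    simp at this
  rw [Fintype.not_linearIndependent_iff] at hdep
  obtain ⟨c, hc0, k, hk⟩ := hdep
  by_cases hp : ∃ i, 0 < c i
  · by_cases hn : ∃ i, c i < 0
    · obtain ⟨p, hp⟩ := hp
      obtain ⟨n, hn⟩ := hn
      have heq : ∑ i, max (c i) 0 • s i = ∑ i, max (-(c i)) 0 • s i := by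
        rw [← sub_eq_zero, ← Finset.sum_sub_distrib, ← hc0]
        apply Finset.sum_congr rfl
        intro i _
        rw [← sub_smul]
        congr 1
        rcases le_total 0 (c i) with h | h
        · rw [max_eq_left h, max_eq_right (by linarith)]; ring
        · rw [max_eq_right h, max_eq_left (by linarith)]; ring
      refine ⟨∑ i, max (c i) 0 • s i, fun j => ?_⟩
      have gen : ∀ d : Fin 4 → ℝ, (∀ i, 0 ≤ d i) → d j = 0 → (∃ k, 0 < d k) →
          ∑ i, d i • s i ∈ sepCone (e j) := by
        rintro d hd hdj ⟨k, hk⟩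
        rw [mem_sepCone, sideVal_sum, sideVal_sum]
        constructor
        · have := sum_pos_aux d (fun i => - sideVal (s i) (e j).1) j k hd
            (fun i hi => neg_pos.2 (hs i j hi.symm).1) hdj hk
          simp only [mul_neg, Finset.sum_neg_distrib] at this
          linarith
        · exact sum_pos_aux d (fun i => sideVal (s i) (e j).2) j k hd
            (fun i hi => (hs i j hi.symm).2) hdj hk
      rcases le_total (c j) 0 with h | h
      · exact gen (fun i => max (c i) 0) (fun i => le_max_right _ _) (max_eq_right h)
          ⟨p, lt_max_of_lt_left hp⟩
      · rw [heq]
        exact gen (fun i => max (-(c i)) 0) (fun i => le_max_right _ _)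
          (max_eq_right (by linarith)) ⟨n, lt_max_of_lt_left (by linarith)⟩
    · push Not at hn
      obtain ⟨p, hp⟩ := hp
      exact (no_pos_dep e hlow s hs c hn p hp hc0).elim
  · push Not at hp
    refine (no_pos_dep e hlow s hs (fun i => -(c i)) (fun i => by have := hp i; linarith) k
      (by have := lt_of_le_of_ne (hp k) hk; linarith) ?_).elim
    simp only [neg_smul, Finset.sum_neg_distrib, hc0, neg_zero]

theorem dt_crs (e f : (ℝ × ℝ) × (ℝ × ℝ)) : dt e.1 e.2 f.2 - dt e.1 e.2 f.1 = crs e f := by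
  unfold dt crs; ring

theorem crs_swap (e f : (ℝ × ℝ) × (ℝ × ℝ)) : crs f e = - crs e f := by
  unfold crs; ring

theorem crs_trans {e f g : (ℝ × ℝ) × (ℝ × ℝ)} (he : e.1.2 < e.2.2) (hf : f.1.2 < f.2.2)
    (hg : g.1.2 < g.2.2) (h1 : 0 < crs e f) (h2 : 0 < crs f g) : 0 < crs e g := by
  have h : (f.2.2 - f.1.2) * crs e g = (g.2.2 - g.1.2) * crs e f + (e.2.2 - e.1.2) * crs f g := by
    unfold crs; ring
  have := mul_pos (sub_pos.2 hg) h1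
  have := mul_pos (sub_pos.2 he) h2
  exact pos_of_mul_pos_right (by linarith : 0 < (f.2.2 - f.1.2) * crs e g) (sub_pos.2 hf).le

/-- Two edges one of whose lines separates the endpoints of the other. -/
theorem two {e f : (ℝ × ℝ) × (ℝ × ℝ)} (h : dt e.1 e.2 f.1 * dt e.1 e.2 f.2 < 0) :
    ∃ l, l ∈ sepCone e ∧ l ∈ sepCone f := by
  have hsw : ∀ p, dt e.2 e.1 p = - dt e.1 e.2 p := by intro p; unfold dt; ring
  have main : ∀ σ : ℝ, 0 < σ * dt e.2 e.1 f.2 → σ * dt e.2 e.1 f.1 < 0 →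
      ∃ l, l ∈ sepCone e ∧ l ∈ sepCone f := by
    intro σ h1 h2
    obtain ⟨l, ⟨q1, q2, -⟩, ⟨q3, q4, -⟩⟩ := perturb3 σ e.2 e.1 f.2 e.2 f.2 f.2 e.1 f.1 f.1
      (by intro h0; rw [h0] at h1; simp at h1) (Or.inl rfl) (Or.inr h1) (Or.inr h1) (Or.inl rfl)
      (Or.inr h2) (Or.inr h2)
    exact ⟨l, ⟨q3, q1⟩, ⟨q4, q2⟩⟩
  rcases mul_neg_iff.mp h with ⟨p, q⟩ | ⟨p, q⟩
  · exact main 1 (by rw [hsw]; linarith) (by rw [hsw]; linarith)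
  · exact main (-1) (by rw [hsw]; linarith) (by rw [hsw]; linarith)

theorem dt_rot (p q r : ℝ × ℝ) : dt q r p = dt p q r := by unfold dt; ring

theorem exists_four {α : Type*} [DecidableEq α] (I : Finset α) (h : I.card ≤ 4) :
    I = ∅ ∨ ∃ e : Fin 4 → α, (∀ i, e i ∈ I) ∧ ∀ x ∈ I, ∃ i, e i = x := by
  rcases I.eq_empty_or_nonempty with h0 | ⟨x0, hx0⟩
  · exact Or.inl h0
  right
  let φ := I.equivFin
  refine ⟨fun i => if hi : i.1 < I.card then (φ.symm ⟨i.1, hi⟩ : α) else x0, ?_, ?_⟩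
  · intro i
    dsimp only
    split_ifs with hi
    · exact (φ.symm ⟨i.1, hi⟩).2
    · exact hx0
  · intro x hx
    refine ⟨⟨(φ ⟨x, hx⟩).1, lt_of_lt_of_le (φ ⟨x, hx⟩).2 h⟩, ?_⟩
    simp


/-- The orientation data of a matching used in the proof. -/
structure Good (M : Finset ((ℝ × ℝ) × (ℝ × ℝ))) : Prop where
  low : ∀ e ∈ M, e.1.2 < e.2.2
  nz : ∀ p ∈ endpoints M, ∀ q ∈ endpoints M, ∀ r ∈ endpoints M, p ≠ q → p ≠ r → q ≠ r →
    dt p q r ≠ 0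
  disj : ∀ e ∈ M, ∀ f ∈ M, e ≠ f → e.1 ≠ f.1 ∧ e.1 ≠ f.2 ∧ e.2 ≠ f.1 ∧ e.2 ≠ f.2
  opp : ∀ e ∈ M, ∀ f ∈ M, e ≠ f →
    dt e.1 e.2 f.1 * dt e.1 e.2 f.2 < 0 ∨ dt f.1 f.2 e.1 * dt f.1 f.2 e.2 < 0
  condB : ∀ e ∈ M, ∀ f ∈ M, ∀ g ∈ M, e ≠ f → e ≠ g → f ≠ g → CondB e.1 e.2 f.1 f.2 g.1 g.2
  condC : ∀ e ∈ M, ∀ f ∈ M, ∀ g ∈ M, e ≠ f → e ≠ g → f ≠ g → CondC e.1 e.2 f.1 f.2 g.1 g.2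

theorem mem_endpoints_fst {M : Finset ((ℝ × ℝ) × (ℝ × ℝ))} {e : (ℝ × ℝ) × (ℝ × ℝ)} (he : e ∈ M) :
    e.1 ∈ endpoints M :=
  Finset.mem_union_left _ (Finset.mem_image_of_mem _ he)

theorem mem_endpoints_snd {M : Finset ((ℝ × ℝ) × (ℝ × ℝ))} {e : (ℝ × ℝ) × (ℝ × ℝ)} (he : e ∈ M) :
    e.2 ∈ endpoints M :=
  Finset.mem_union_right _ (Finset.mem_image_of_mem _ he)

theorem ne_of_low {e : (ℝ × ℝ) × (ℝ × ℝ)} (h : e.1.2 < e.2.2) : e.1 ≠ e.2 := by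
  intro h0; rw [h0] at h; exact lt_irrefl _ h

theorem crs_ne_zero_of_opp {e f : (ℝ × ℝ) × (ℝ × ℝ)}
    (h : dt e.1 e.2 f.1 * dt e.1 e.2 f.2 < 0 ∨ dt f.1 f.2 e.1 * dt f.1 f.2 e.2 < 0) :
    crs e f ≠ 0 := by
  intro h0
  have h1 := dt_crs e f
  have h2 := dt_crs f e
  rw [crs_swap e f, h0] at h2
  rw [h0] at h1
  have h1' : dt e.1 e.2 f.2 = dt e.1 e.2 f.1 := by linarith
  have h2' : dt f.1 f.2 e.2 = dt f.1 f.2 e.1 := by linarith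
  rw [h1', h2'] at h
  rcases h with h | h
  · linarith [mul_self_nonneg (dt e.1 e.2 f.1)]
  · linarith [mul_self_nonneg (dt f.1 f.2 e.1)]

/-- If the line of `e` splits `g` but not conversely, then `e` stabs `g`. -/
theorem segStabs_of {e g : (ℝ × ℝ) × (ℝ × ℝ)} (h1 : dt e.1 e.2 g.1 * dt e.1 e.2 g.2 < 0)
    (h2 : 0 < dt g.1 g.2 e.1 * dt g.1 g.2 e.2) : SegStabs e.1 e.2 g.1 g.2 := by
  have hne := crs_ne_zero_of_opp (Or.inl h1)
  have hd := dt_crs g e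
  rw [crs_swap e g] at hd
  have hne' : dt g.1 g.2 e.2 - dt g.1 g.2 e.1 ≠ 0 := by
    rw [hd]; exact neg_ne_zero.2 hne
  by_cases hk : 0 < dt g.1 g.2 e.1 * (dt g.1 g.2 e.2 - dt g.1 g.2 e.1)
  · exact (stabVertex_of (Or.inl ⟨rfl, rfl⟩) h1 hk).segStabs
  · refine (stabVertex_of (v := e.2) (w := e.1) (Or.inr ⟨rfl, rfl⟩) h1 ?_).segStabs
    generalize dt g.1 g.2 e.1 = x at *
    generalize dt g.1 g.2 e.2 = y at *
    rcases pos_and_pos_or_neg_and_neg_of_mul_pos h2 with ⟨p, q⟩ | ⟨p, q⟩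
    · rcases lt_or_gt_of_ne hne' with h | h
      · exact mul_pos q (by linarith)
      · exact (hk (mul_pos p h)).elim
    · rcases lt_or_gt_of_ne hne' with h | h
      · exact (hk (mul_pos_of_neg_of_neg p h)).elim
      · exact mul_pos_of_neg_of_neg q (by linarith)

namespace Good

variable {M : Finset ((ℝ × ℝ) × (ℝ × ℝ))}

theorem lt_of_crs {e f : (ℝ × ℝ) × (ℝ × ℝ)} (h : 0 < crs e f) :
    dt e.1 e.2 f.1 < dt e.1 e.2 f.2 ∧ dt f.1 f.2 e.2 < dt f.1 f.2 e.1 := by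
  have h1 := dt_crs e f
  have h2 := dt_crs f e
  rw [crs_swap e f] at h2
  constructor <;> linarith

theorem triple_sorted (G : Good M) {e f g : (ℝ × ℝ) × (ℝ × ℝ)} (he : e ∈ M) (hf : f ∈ M)
    (hg : g ∈ M) (ef : e ≠ f) (eg : e ≠ g) (fg : f ≠ g)
    (h1 : 0 < crs e f) (h2 : 0 < crs e g) (h3 : 0 < crs f g) :
    ∃ l, l ∈ sepCone e ∧ l ∈ sepCone f ∧ l ∈ sepCone g := by
  obtain ⟨a1, a2, a3, a4⟩ := G.disj e he f hf ef
  obtain ⟨b1, b2, b3, b4⟩ := G.disj e he g hg eg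
  obtain ⟨c1, c2, c3, c4⟩ := G.disj f hf g hg fg
  have e0 := ne_of_low (G.low e he)
  have f0 := ne_of_low (G.low f hf)
  have g0 := ne_of_low (G.low g hg)
  have E1 := mem_endpoints_fst he
  have E2 := mem_endpoints_snd he
  have F1 := mem_endpoints_fst hf
  have F2 := mem_endpoints_snd hf
  have G1 := mem_endpoints_fst hg
  have G2 := mem_endpoints_snd hg
  obtain ⟨l, ⟨r0, r1, r2⟩, ⟨s0, s1, s2⟩⟩ := three e.1 e.2 f.1 f.2 g.1 g.2
    (G.nz _ E1 _ E2 _ F1 e0 a1 a3) (G.nz _ E1 _ E2 _ F2 e0 a2 a4)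
    (G.nz _ E1 _ E2 _ G1 e0 b1 b3) (G.nz _ E1 _ E2 _ G2 e0 b2 b4)
    (G.nz _ F1 _ F2 _ E1 f0 a1.symm a2.symm)
    (G.nz _ E1 _ F1 _ G1 a1 b1 c1) (G.nz _ E1 _ F1 _ G2 a1 b2 c2)
    (G.nz _ E1 _ F2 _ G1 a2 b1 c3) (G.nz _ E1 _ F2 _ G2 a2 b2 c4)
    (G.nz _ G1 _ G2 _ E1 g0 b1.symm b2.symm)
    (G.nz _ F1 _ F2 _ E2 f0 a3.symm a4.symm)
    (G.nz _ E2 _ F1 _ G1 a3 b3 c1) (G.nz _ E2 _ F1 _ G2 a3 b4 c2)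
    (G.nz _ E2 _ F2 _ G1 a4 b3 c3) (G.nz _ E2 _ F2 _ G2 a4 b4 c4)
    (G.nz _ G1 _ G2 _ E2 g0 b3.symm b4.symm)
    (G.nz _ F1 _ F2 _ G1 f0 c1 c3) (G.nz _ F1 _ F2 _ G2 f0 c2 c4)
    (G.nz _ G1 _ G2 _ F1 g0 c1.symm c2.symm) (G.nz _ G1 _ G2 _ F2 g0 c3.symm c4.symm)
    (lt_of_crs h1).1 (lt_of_crs h1).2 (G.opp e he f hf ef)
    (lt_of_crs h2).1 (lt_of_crs h2).2 (G.opp e he g hg eg)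
    (lt_of_crs h3).1 (lt_of_crs h3).2 (G.opp f hf g hg fg)
    (G.condB f hf e he g hg ef.symm fg eg) (G.condB f hf g hg e he fg ef.symm eg.symm)
    (G.condC f hf e he g hg ef.symm fg eg) (G.condC f hf g hg e he fg ef.symm eg.symm)
    (G.condC g hg e he f hf eg.symm fg.symm ef) (G.condC g hg f hf e he fg.symm eg.symm ef.symm)
  exact ⟨l, ⟨s0, r0⟩, ⟨s1, r1⟩, ⟨s2, r2⟩⟩

theorem single (G : Good M) {e : (ℝ × ℝ) × (ℝ × ℝ)} (he : e ∈ M) : ∃ l, l ∈ sepCone e := by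
  have := G.low e he
  refine ⟨(0, 1, (e.1.2 + e.2.2) / 2), ?_⟩
  rw [mem_sepCone]
  simp only [sideVal]
  constructor <;> linarith

theorem pair (G : Good M) {e f : (ℝ × ℝ) × (ℝ × ℝ)} (he : e ∈ M) (hf : f ∈ M) :
    ∃ l, l ∈ sepCone e ∧ l ∈ sepCone f := by
  by_cases h : e = f
  · subst h
    obtain ⟨l, hl⟩ := G.single he
    exact ⟨l, hl, hl⟩
  · rcases G.opp e he f hf h with h | h
    · exact two h
    · obtain ⟨l, h1, h2⟩ := two h
      exact ⟨l, h2, h1⟩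

theorem triple (G : Good M) {e f g : (ℝ × ℝ) × (ℝ × ℝ)} (he : e ∈ M) (hf : f ∈ M) (hg : g ∈ M) :
    ∃ l, l ∈ sepCone e ∧ l ∈ sepCone f ∧ l ∈ sepCone g := by
  by_cases ef : e = f
  · subst ef
    obtain ⟨l, h1, h2⟩ := G.pair he hg
    exact ⟨l, h1, h1, h2⟩
  by_cases eg : e = g
  · subst eg
    obtain ⟨l, h1, h2⟩ := G.pair he hf
    exact ⟨l, h1, h2, h1⟩
  by_cases fg : f = g
  · subst fg
    obtain ⟨l, h1, h2⟩ := G.pair he hf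
    exact ⟨l, h1, h2, h2⟩
  have total : ∀ {a b : (ℝ × ℝ) × (ℝ × ℝ)}, a ∈ M → b ∈ M → a ≠ b → 0 < crs a b ∨ 0 < crs b a := by
    intro a b ha hb hab
    rcases lt_or_gt_of_ne (crs_ne_zero_of_opp (G.opp a ha b hb hab)) with h | h
    · right; rw [crs_swap a b]; linarith
    · exact Or.inl h
  have key : ∀ {a b c : (ℝ × ℝ) × (ℝ × ℝ)}, a ∈ M → b ∈ M → c ∈ M → a ≠ b → a ≠ c → b ≠ c →
      0 < crs a b → 0 < crs b c → ∃ l, l ∈ sepCone a ∧ l ∈ sepCone b ∧ l ∈ sepCone c := by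
    intro a b c ha hb hc hab hac hbc h1 h2
    exact G.triple_sorted ha hb hc hab hac hbc h1
      (crs_trans (G.low a ha) (G.low b hb) (G.low c hc) h1 h2) h2
  rcases total he hf ef with h1 | h1
  · rcases total hf hg fg with h2 | h2
    · exact key he hf hg ef eg fg h1 h2
    · rcases total he hg eg with h3 | h3
      · obtain ⟨l, x, y, z⟩ := key he hg hf eg ef (Ne.symm fg) h3 h2
        exact ⟨l, x, z, y⟩
      · obtain ⟨l, x, y, z⟩ := key hg he hf (Ne.symm eg) (Ne.symm fg) ef h3 h1
        exact ⟨l, y, z, x⟩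
  · rcases total he hg eg with h2 | h2
    · obtain ⟨l, x, y, z⟩ := key hf he hg (Ne.symm ef) fg eg h1 h2
      exact ⟨l, y, x, z⟩
    · rcases total hf hg fg with h3 | h3
      · obtain ⟨l, x, y, z⟩ := key hf hg he fg (Ne.symm ef) (Ne.symm eg) h3 h2
        exact ⟨l, z, x, y⟩
      · obtain ⟨l, x, y, z⟩ := key hg hf he (Ne.symm fg) (Ne.symm eg) (Ne.symm ef) h3 h1
        exact ⟨l, z, y, x⟩

theorem quad (G : Good M) (e : Fin 4 → (ℝ × ℝ) × (ℝ × ℝ)) (he : ∀ i, e i ∈ M) :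
    ∃ t, ∀ j, t ∈ sepCone (e j) := by
  have h : ∀ i : Fin 4, ∃ l, ∀ j, j ≠ i → l ∈ sepCone (e j) := by
    intro i
    obtain ⟨a, b, c, habc⟩ : ∃ a b c : Fin 4, ∀ j, j ≠ i → j = a ∨ j = b ∨ j = c := by
      revert i; decide
    obtain ⟨l, h1, h2, h3⟩ := G.triple (he a) (he b) (he c)
    refine ⟨l, fun j hj => ?_⟩
    rcases habc j hj with rfl | rfl | rfl <;> assumption
  choose s hs using h
  exact four e (fun i => G.low _ (he i)) s hs

theorem all (G : Good M) : ∃ l, ∀ e ∈ M, l ∈ sepCone e := by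
  have h := Convex.helly_theorem' (𝕜 := ℝ) (s := M) (F := sepCone)
    (fun e _ => convex_sepCone e) (by
      intro I hI hcard
      simp only [Module.finrank_prod, Module.finrank_self] at hcard
      rcases exists_four I (by omega) with rfl | ⟨e, h1, h2⟩
      · simp
      · obtain ⟨t, ht⟩ := G.quad e fun i => hI (h1 i)
        refine ⟨t, ?_⟩
        simp only [Set.mem_iInter]
        intro x hx
        obtain ⟨i, rfl⟩ := h2 x hx
        exact ht i)
  obtain ⟨l, hl⟩ := h
  simp only [Set.mem_iInter] at hl
  exact ⟨l, hl⟩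

end Good

theorem disjoint_hulls (l : ℝ × ℝ × ℝ) (R B : Set (ℝ × ℝ)) (hR : ∀ p ∈ R, 0 < sideVal l p)
    (hB : ∀ p ∈ B, sideVal l p < 0) : Disjoint (convexHull ℝ R) (convexHull ℝ B) := by
  have aff : ∀ (p q : ℝ × ℝ) (a b : ℝ), a + b = 1 →
      sideVal l (a • p + b • q) = a * sideVal l p + b * sideVal l q := by
    intro p q a b hab
    obtain rfl : b = 1 - a := by linarith
    simp only [sideVal, Prod.fst_add, Prod.snd_add, Prod.smul_fst, Prod.smul_snd, smul_eq_mul]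
    ring
  have c1 : Convex ℝ {p : ℝ × ℝ | 0 < sideVal l p} := by
    intro p hp q hq a b ha hb hab
    simp only [Set.mem_ofPred_eq] at hp hq ⊢
    rw [aff p q a b hab]
    exact comb_pos ha hb hab hp hq
  have c2 : Convex ℝ {p : ℝ × ℝ | sideVal l p < 0} := by
    intro p hp q hq a b ha hb hab
    simp only [Set.mem_ofPred_eq] at hp hq ⊢
    rw [aff p q a b hab]
    have := comb_pos ha hb hab (neg_pos.2 hp) (neg_pos.2 hq)
    linarith
  rw [Set.disjoint_left]
  intro p h1 h2
  have k1 : 0 < sideVal l p := convexHull_min hR c1 h1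
  have k2 : sideVal l p < 0 := convexHull_min hB c2 h2
  exact lt_asymm k1 k2

theorem stmt15 (M : Finset ((ℝ × ℝ) × (ℝ × ℝ)))
    (hgp : GenPos ((endpoints M : Finset (ℝ × ℝ)) : Set (ℝ × ℝ)))
    (hdisj : ∀ e ∈ M, ∀ f ∈ M, e ≠ f →
      e.1 ≠ f.1 ∧ e.1 ≠ f.2 ∧ e.2 ≠ f.1 ∧ e.2 ≠ f.2)
    (hlow : ∀ e ∈ M, e.1.2 < e.2.2)
    (hslope : ∀ e ∈ M, e.1.1 ≠ e.2.1)
    (ha : ∀ e ∈ M, ∀ f ∈ M, e ≠ f → ¬ SegParallel e.1 e.2 f.1 f.2)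
    (hb : ∀ e ∈ M, ∀ f ∈ M, ∀ g ∈ M, e ≠ f → e ≠ g → f ≠ g →
      ∀ v, StabVertex e.1 e.2 f.1 f.2 v → SegStabs e.1 e.2 g.1 g.2 →
        v ∈ convexHull ℝ ({f.1, f.2, g.1, g.2} : Set (ℝ × ℝ)))
    (hc : ∀ e ∈ M, ∀ f ∈ M, ∀ g ∈ M, e ≠ f → e ≠ g → f ≠ g →
      SegStabs e.1 e.2 f.1 f.2 → ∀ v, StabVertex f.1 f.2 g.1 g.2 v →
        v ∈ convexHull ℝ ({e.1, e.2, g.1, g.2} : Set (ℝ × ℝ))) :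
    Disjoint (convexHull ℝ ((M.image Prod.snd : Finset (ℝ × ℝ)) : Set (ℝ × ℝ)))
      (convexHull ℝ ((M.image Prod.fst : Finset (ℝ × ℝ)) : Set (ℝ × ℝ))) ∧
    ∃ l : ℝ × ℝ × ℝ, (l.1, l.2.1) ≠ (0, 0) ∧
      (∀ p ∈ M.image Prod.snd, 0 < sideVal l p) ∧
      (∀ p ∈ M.image Prod.fst, sideVal l p < 0) := by
  have nz : ∀ p ∈ endpoints M, ∀ q ∈ endpoints M, ∀ r ∈ endpoints M, p ≠ q → p ≠ r → q ≠ r →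
      dt p q r ≠ 0 := by
    intro p hp q hq r hr hpq hpr hqr h0
    exact hgp p (by exact_mod_cast hp) q (by exact_mod_cast hq) r (by exact_mod_cast hr)
      hpq hpr hqr (collinear_of_dt hpq h0)
  have G : Good M := by
    refine ⟨hlow, nz, hdisj, ?_, ?_, ?_⟩
    · intro e he f hf hef
      obtain ⟨a1, a2, a3, a4⟩ := hdisj e he f hf hef
      have e0 := ne_of_low (hlow e he)
      have f0 := ne_of_low (hlow f hf)
      have E1 := mem_endpoints_fst he
      have E2 := mem_endpoints_snd he
      have F1 := mem_endpoints_fst hf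
      have F2 := mem_endpoints_snd hf
      exact sep_of_not_parallel e0 f0 (nz _ E1 _ E2 _ F1 e0 a1 a3) (nz _ E1 _ E2 _ F2 e0 a2 a4)
        (nz _ F1 _ F2 _ E1 f0 a1.symm a2.symm) (nz _ F1 _ F2 _ E2 f0 a3.symm a4.symm)
        (ha e he f hf hef)
    · intro e he f hf g hg ef eg fg v w hvw h1 h2 h3 h4
      exact hb e he f hf g hg ef eg fg v (stabVertex_of hvw h1 h2) (segStabs_of h3 h4)
    · intro g hg e he f hf ge gf ef v w hvw h1 h2 h3 h4
      exact hc g hg e he f hf ge gf ef (segStabs_of h3 h4) v (stabVertex_of hvw h1 h2)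
  obtain ⟨l0, hl0⟩ := G.all
  obtain ⟨l, hlne, hl⟩ : ∃ l : ℝ × ℝ × ℝ, (l.1, l.2.1) ≠ (0, 0) ∧ ∀ e ∈ M, l ∈ sepCone e := by
    rcases M.eq_empty_or_nonempty with hM | ⟨e, he⟩
    · refine ⟨(1, 0, 0), by simp, ?_⟩
      intro e he
      rw [hM] at he
      simp at he
    · refine ⟨l0, ?_, hl0⟩
      intro h0
      obtain ⟨h1, h2⟩ := Prod.mk.inj h0
      have h3 := hl0 e he
      rw [mem_sepCone] at h3
      simp only [sideVal, h1, h2] at h3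
      linarith [h3.1, h3.2]
  have hR : ∀ p ∈ M.image Prod.snd, 0 < sideVal l p := by
    intro p hp
    obtain ⟨e, he, rfl⟩ := Finset.mem_image.mp hp
    exact (hl e he).2
  have hB : ∀ p ∈ M.image Prod.fst, sideVal l p < 0 := by
    intro p hp
    obtain ⟨e, he, rfl⟩ := Finset.mem_image.mp hp
    exact (hl e he).1
  exact ⟨disjoint_hulls l _ _ (fun p hp => hR p (Finset.mem_coe.mp hp))
    (fun p hp => hB p (Finset.mem_coe.mp hp)), l, hlne, hR, hB⟩
end
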